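/- arXiv:1804.01358 — 11 statements merged into one kernel-verified Lean document; each statement's English description precedes it below -/
import Mathlib

section
/- Let n ≥ 2 and let A ∈ S_n be a third-order symmetric tensor. The following three conditions are equivalent: (i) for every pair 1 ≤ i < j ≤ n, θ = 0 is a global maximum point of the function h_{i,j}(θ) (i.e. A is Jacobi diagonal); (ii) for every pair 1 ≤ i < j ≤ n, θ = 0 is a local maximum point of h_{i,j}(θ) (i.e. A is locally Jacobi diagonal); (iii) for every pair 1 ≤ i < j ≤ n, d_{i,j}(A) = 0 and ω_{i,j}(A) ≥ 0. -/
open scoped BigOperators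
open Matrix

/-- Orthogonal transform of a third-order tensor by a matrix `Q`:
`W i j k = ∑ p q r, A p q r * Q p i * Q q j * Q r k`. -/
def transform (n : ℕ) (A : Fin n → Fin n → Fin n → ℝ) (Q : Matrix (Fin n) (Fin n) ℝ) :
    Fin n → Fin n → Fin n → ℝ :=
  fun i j k => ∑ p, ∑ q, ∑ r, A p q r * Q p i * Q q j * Q r k

/-- The objective `f(Q) = ∑ i, W i i i ^ 2`. -/
def fObj (n : ℕ) (A : Fin n → Fin n → Fin n → ℝ) (Q : Matrix (Fin n) (Fin n) ℝ) : ℝ :=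
  ∑ i, (transform n A Q i i i) ^ 2

/-- A third-order tensor is symmetric if its entries are invariant under all permutations
of the indices (transpositions of adjacent indices suffice). -/
def IsSymT (n : ℕ) (A : Fin n → Fin n → Fin n → ℝ) : Prop :=
  ∀ i j k : Fin n, A i j k = A j i k ∧ A i j k = A i k j

/-- The Givens rotation `G^{(i,j,θ)}`. -/
noncomputable def givens (n : ℕ) (i j : Fin n) (θ : ℝ) : Matrix (Fin n) (Fin n) ℝ :=
  Matrix.of fun k l =>
    if k = l then (if k = i ∨ k = j then Real.cos θ else 1)
    else if k = j ∧ l = i then Real.sin θ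
    else if k = i ∧ l = j then -Real.sin θ
    else 0

/-- `d_{i,j}(A)`. -/
def dT (n : ℕ) (A : Fin n → Fin n → Fin n → ℝ) (i j : Fin n) : ℝ :=
  A i i i * A i i j - A i j j * A j j j

/-- `ω_{i,j}(A)`. -/
def ωT (n : ℕ) (A : Fin n → Fin n → Fin n → ℝ) (i j : Fin n) : ℝ :=
  A i i i ^ 2 + A j j j ^ 2 - 3 * A i i j ^ 2 - 3 * A i j j ^ 2
    - 2 * A i i i * A i j j - 2 * A i i j * A j j j

theorem aux_sum (n : ℕ) (F : Fin n → ℝ) (i j : Fin n) (x y : ℝ) :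
    ∑ p, F p * ((if p = i then x else 0) + (if p = j then y else 0)) = F i * x + F j * y := by
  simp [mul_add, Finset.sum_add_distrib]

theorem aux_tr (n : ℕ) (A : Fin n → Fin n → Fin n → ℝ) (Q : Matrix (Fin n) (Fin n) ℝ)
    (i j k : Fin n) (x y : ℝ)
    (h : ∀ p, Q p k = (if p = i then x else 0) + (if p = j then y else 0)) :
    transform n A Q k k k =
      ((A i i i * x + A i i j * y) * x + (A i j i * x + A i j j * y) * y) * x +
      ((A j i i * x + A j i j * y) * x + (A j j i * x + A j j j * y) * y) * y := by
  have e : transform n A Q k k k =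
      ∑ p, (∑ q, (∑ r, A p q r * ((if r = i then x else 0) + (if r = j then y else 0))) *
        ((if q = i then x else 0) + (if q = j then y else 0))) *
        ((if p = i then x else 0) + (if p = j then y else 0)) := by
    unfold transform
    refine Finset.sum_congr rfl fun p _ => ?_
    rw [Finset.sum_mul]
    refine Finset.sum_congr rfl fun q _ => ?_
    rw [Finset.sum_mul, Finset.sum_mul]
    refine Finset.sum_congr rfl fun r _ => ?_
    rw [h p, h q, h r]
    ring
  rw [e]
  simp only [aux_sum]

theorem aux_h (n : ℕ) (A : Fin n → Fin n → Fin n → ℝ) (hA : IsSymT n A) (i j : Fin n)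
    (hij : i < j) (θ : ℝ) :
    fObj n A (givens n i j θ) = fObj n A (givens n i j 0) +
      (6 * dT n A i j * (Real.cos θ * Real.sin θ * (Real.cos θ ^ 2 - Real.sin θ ^ 2))
        - 3 * ωT n A i j * (Real.cos θ * Real.sin θ) ^ 2) := by
  have hne : i ≠ j := ne_of_lt hij
  have s1 : A i j i = A i i j := ((hA i i j).2).symm
  have s2 : A j i i = A i i j := by rw [(hA j i i).1, s1]
  have s3 : A j i j = A i j j := (hA j i j).1
  have s4 : A j j i = A i j j := by rw [(hA j j i).2, s3]
  have hi : ∀ t, transform n A (givens n i j t) i i i = A i i i * Real.cos t ^ 3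
      + 3 * A i i j * Real.cos t ^ 2 * Real.sin t + 3 * A i j j * Real.cos t * Real.sin t ^ 2
      + A j j j * Real.sin t ^ 3 := by
    intro t
    rw [aux_tr n A _ i j i (Real.cos t) (Real.sin t), s1, s2, s3, s4]
    · ring
    · intro p
      simp only [givens, Matrix.of_apply]
      grind
  have hj : ∀ t, transform n A (givens n i j t) j j j = - A i i i * Real.sin t ^ 3
      + 3 * A i i j * Real.sin t ^ 2 * Real.cos t - 3 * A i j j * Real.sin t * Real.cos t ^ 2
      + A j j j * Real.cos t ^ 3 := by
    intro t
    rw [aux_tr n A _ i j j (-Real.sin t) (Real.cos t), s1, s2, s3, s4]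
    · ring
    · intro p
      simp only [givens, Matrix.of_apply]
      grind
  have hk : ∀ t k, k ≠ i → k ≠ j → transform n A (givens n i j t) k k k = A k k k := by
    intro t k h1 h2
    rw [aux_tr n A _ k k k 1 0]
    · ring
    · intro p
      simp only [givens, Matrix.of_apply]
      grind
  have hf : ∀ t, fObj n A (givens n i j t) =
      (transform n A (givens n i j t) i i i) ^ 2 + ((transform n A (givens n i j t) j j j) ^ 2 +
        ∑ k ∈ (Finset.univ.erase i).erase j, A k k k ^ 2) := by
    intro t
    unfold fObj
    rw [← Finset.add_sum_erase _ _ (Finset.mem_univ i),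
      ← Finset.add_sum_erase _ _ (Finset.mem_erase.2 ⟨hne.symm, Finset.mem_univ j⟩)]
    congr 2
    apply Finset.sum_congr rfl
    intro k hk'
    simp only [Finset.mem_erase, Finset.mem_univ, and_true] at hk'
    rw [hk t k hk'.2 hk'.1]
  rw [hf θ, hf 0, hi, hi, hj, hj]
  simp only [Real.cos_zero, Real.sin_zero, dT, ωT]
  have hc : Real.sin θ ^ 2 = 1 - Real.cos θ ^ 2 := by rw [Real.sin_sq]
  generalize Real.sin θ = y at *
  generalize Real.cos θ = x at *
  have h3 : (x ^ 2 + y ^ 2) = 1 := by rw [hc]; ring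
  generalize A i i i = a
  generalize A i i j = b
  generalize A i j j = c
  generalize A j j j = d
  have e1 : (a ^ 2 + d ^ 2) = (a ^ 2 + d ^ 2) * (x ^ 2 + y ^ 2) ^ 3 := by rw [h3]; ring
  have e2 : (6 * (a * b - c * d) * (x * y * (x ^ 2 - y ^ 2))) =
    (6 * (a * b - c * d) * (x * y * (x ^ 2 - y ^ 2))) * (x ^ 2 + y ^ 2) := by rw [h3]; ring
  have e3 (w : ℝ) : 3 * w * (x * y) ^ 2 = 3 * w * (x * y) ^ 2 * (x ^ 2 + y ^ 2) := by
    rw [h3]; ring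
  rw [e2, e3]
  linear_combination (-1) * e1

theorem aux_loc (D w : ℝ) (h : IsLocalMax (fun θ : ℝ =>
      6 * D * (Real.cos θ * Real.sin θ * (Real.cos θ ^ 2 - Real.sin θ ^ 2))
        - 3 * w * (Real.cos θ * Real.sin θ) ^ 2) 0) : D = 0 ∧ 0 ≤ w := by
  have hc := Real.hasDerivAt_cos 0
  have hs := Real.hasDerivAt_sin 0
  have hd := (((hc.mul hs).mul ((hc.pow 2).sub (hs.pow 2))).const_mul (6 * D)).sub
    (((hc.mul hs).pow 2).const_mul (3 * w))
  have h0 := h.hasDerivAt_eq_zero hd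
  have hD : D = 0 := by simpa using h0
  refine ⟨hD, ?_⟩
  subst hD
  obtain ⟨ε, hε, hb⟩ := Metric.eventually_nhds_iff.1 h
  set t := min (ε / 2) 1 with ht
  have ht0 : 0 < t := by positivity
  have ht1 : t ≤ 1 := min_le_right _ _
  have ht2 : t < ε := lt_of_le_of_lt (min_le_left _ _) (by linarith)
  have h1 := hb (y := t) (by simpa [abs_of_pos ht0] using ht2)
  have p1 : 0 < Real.sin t := Real.sin_pos_of_pos_of_lt_pi ht0 (by linarith [Real.pi_gt_three])
  have p2 : 0 < Real.cos t := Real.cos_pos_of_le_one (by rwa [abs_of_pos ht0])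
  have p3 : 0 < (Real.cos t * Real.sin t) ^ 2 := by positivity
  simp at h1
  by_contra hw
  push Not at hw
  nlinarith

/-- Lemma 3.10 / `lemma-C3-h`.
For a symmetric tensor `A ∈ S_n`, `n ≥ 2`, the following are equivalent:
(i) `A` is Jacobi diagonal: for every pair `i < j`, `θ = 0` is a global maximum of
`h_{i,j}(θ) = f(G^{(i,j,θ)})`;
(ii) `A` is locally Jacobi diagonal: `θ = 0` is a local maximum of every `h_{i,j}`;
(iii) `d_{i,j}(A) = 0` and `ω_{i,j}(A) ≥ 0` for every pair `i < j`. -/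
theorem stmt_0 (n : ℕ) (hn : 2 ≤ n) (A : Fin n → Fin n → Fin n → ℝ) (hA : IsSymT n A) :
    ((∀ i j : Fin n, i < j →
        ∀ θ : ℝ, fObj n A (givens n i j θ) ≤ fObj n A (givens n i j 0)) ↔
      (∀ i j : Fin n, i < j →
        IsLocalMax (fun θ : ℝ => fObj n A (givens n i j θ)) 0)) ∧
    ((∀ i j : Fin n, i < j →
        ∀ θ : ℝ, fObj n A (givens n i j θ) ≤ fObj n A (givens n i j 0)) ↔
      (∀ i j : Fin n, i < j → dT n A i j = 0 ∧ 0 ≤ ωT n A i j)) := by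
  have key : ∀ i j : Fin n, i < j → IsLocalMax (fun θ : ℝ => fObj n A (givens n i j θ)) 0 →
      dT n A i j = 0 ∧ 0 ≤ ωT n A i j := by
    intro i j hij h
    apply aux_loc
    filter_upwards [h] with θ hθ
    rw [aux_h n A hA i j hij θ] at hθ
    simp at hθ ⊢
    linarith
  have key2 : ∀ i j : Fin n, i < j → dT n A i j = 0 ∧ 0 ≤ ωT n A i j →
      ∀ θ : ℝ, fObj n A (givens n i j θ) ≤ fObj n A (givens n i j 0) := by
    intro i j hij h θ
    rw [aux_h n A hA i j hij θ, h.1]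
    have := mul_nonneg h.2 (sq_nonneg (Real.cos θ * Real.sin θ))
    linarith
  have key3 : ∀ i j : Fin n, (∀ θ : ℝ, fObj n A (givens n i j θ) ≤ fObj n A (givens n i j 0)) →
      IsLocalMax (fun θ : ℝ => fObj n A (givens n i j θ)) 0 :=
    fun i j h => Filter.Eventually.of_forall h
  exact ⟨⟨fun h i j hij => key3 i j (h i j hij),
      fun h i j hij => key2 i j hij (key i j hij (h i j hij))⟩,
    ⟨fun h i j hij => key i j hij (key3 i j (h i j hij)),
      fun h i j hij => key2 i j hij (h i j hij)⟩⟩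
end

section
/- Let A ∈ S_n. Then there exists Q ∈ O(n) such that the orthogonal transform of A by Q is pseudo diagonal if and only if there exists an orthonormal basis u_1, …, u_n of ℝⁿ consisting of Z-eigenvectors of A, which in turn is equivalent to the existence of an orthonormal basis u_1, …, u_n with A·u_i·u_i·u_j = 0 for all 1 ≤ i ≠ j ≤ n. Moreover, in that case, taking Q_* to be the matrix with columns u_1, …, u_n, the orthogonal transform of A by Q_* is pseudo diagonal. -/
open scoped BigOperators
open Matrix

/-- A tensor is pseudo diagonal if `B_{iij} = B_{ijj} = 0` for all `i < j`. -/
def PseudoDiag (n : ℕ) (B : Fin n → Fin n → Fin n → ℝ) : Prop :=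
  ∀ i j : Fin n, i < j → B i i j = 0 ∧ B i j j = 0

/-- A family `u : Fin n → (Fin n → ℝ)` is an orthonormal basis of `ℝⁿ`. -/
def OrthonormalFam (n : ℕ) (u : Fin n → Fin n → ℝ) : Prop :=
  ∀ i j : Fin n, (∑ p, u i p * u j p) = if i = j then 1 else 0

theorem aux_swap (n : ℕ) (A : Fin n → Fin n → Fin n → ℝ) (u w : Fin n → ℝ) :
    (∑ p, ∑ q, ∑ k, A p q k * u p * u q * w k) =
      ∑ k, (∑ p, ∑ q, A p q k * u p * u q) * w k := by
  simp only [Finset.sum_mul]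
  have h : ∀ p, (∑ q, ∑ k, A p q k * u p * u q * w k) = ∑ k, ∑ q, A p q k * u p * u q * w k :=
    fun p => Finset.sum_comm
  simp only [h]
  exact Finset.sum_comm

theorem aux_sym (n : ℕ) (A : Fin n → Fin n → Fin n → ℝ) (hA : IsSymT n A) (a b : Fin n → ℝ) :
    (∑ p, ∑ q, ∑ r, A p q r * a p * b q * b r) = ∑ p, ∑ q, ∑ r, A p q r * b p * b q * a r := by
  rw [Finset.sum_comm]
  refine Finset.sum_congr rfl fun q _ => ?_
  rw [Finset.sum_comm]
  refine Finset.sum_congr rfl fun r _ => Finset.sum_congr rfl fun p _ => ?_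
  rw [(hA p q r).1, (hA q p r).2]
  ring

theorem aux_pd (n : ℕ) (A : Fin n → Fin n → Fin n → ℝ) (hA : IsSymT n A)
    (Q : Matrix (Fin n) (Fin n) ℝ) :
    PseudoDiag n (transform n A Q) ↔ ∀ i j : Fin n, i ≠ j →
        (∑ p, ∑ q, ∑ k, A p q k * Q p i * Q q i * Q k j) = 0 := by
  have hs : ∀ i j, transform n A Q i j j = transform n A Q j j i := fun i j =>
    aux_sym n A hA (fun p => Q p i) (fun p => Q p j)
  constructor
  · intro h i j hij
    change transform n A Q i i j = 0
    rcases lt_or_gt_of_ne hij with hl | hl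
    · exact (h i j hl).1
    · rw [← hs]; exact (h j i hl).2
  · intro h i j hij
    refine ⟨h i j hij.ne, ?_⟩
    rw [hs]
    exact h j i hij.ne'

theorem aux_orth (n : ℕ) (Q : Matrix (Fin n) (Fin n) ℝ) :
    Qᵀ * Q = 1 ↔ OrthonormalFam n (fun i p => Q p i) := by
  rw [← Matrix.ext_iff]
  simp [OrthonormalFam, Matrix.mul_apply, Matrix.one_apply]

theorem aux_eig (n : ℕ) (A : Fin n → Fin n → Fin n → ℝ) (u : Fin n → Fin n → ℝ)
    (hu : OrthonormalFam n u) :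
    (∀ i : Fin n, ∃ lam : ℝ,
        ∀ k : Fin n, (∑ p, ∑ q, A p q k * u i p * u i q) = lam * u i k) ↔
    (∀ i j : Fin n, i ≠ j → (∑ p, ∑ q, ∑ k, A p q k * u i p * u i q * u j k) = 0) := by
  constructor
  · intro h i j hij
    obtain ⟨lam, hl⟩ := h i
    rw [aux_swap]
    simp only [hl]
    simp only [mul_assoc]
    rw [← Finset.mul_sum, hu i j, if_neg hij, mul_zero]
  · intro h i
    have hQ := (aux_orth n (Matrix.of fun p i => u i p)).2 hu
    have hQ' := mul_eq_one_comm.1 hQ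
    have hc : ∀ m k : Fin n, (∑ j, u j m * u j k) = if m = k then 1 else 0 := by
      intro m k
      have := congrFun (congrFun hQ' m) k
      simpa [Matrix.mul_apply, Matrix.one_apply] using this
    set v : Fin n → ℝ := fun k => ∑ p, ∑ q, A p q k * u i p * u i q with hv
    refine ⟨∑ m, v m * u i m, fun k => ?_⟩
    have h1 : v k = ∑ j, (∑ m, v m * u j m) * u j k := by
      simp only [Finset.sum_mul, mul_assoc]
      rw [Finset.sum_comm]
      simp only [← Finset.mul_sum, hc]
      simp
    change v k = _
    rw [h1]
    refine Finset.sum_eq_single i (fun j _ hj => ?_) (by simp)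
    have := h i j hj.symm
    rw [aux_swap] at this
    rw [this, zero_mul]

/-- Theorem 3.24(ii) / `theorem-z-PD`(ii).
A symmetric tensor `A ∈ S_n` is orthogonally similar to a pseudo diagonal tensor iff
there is an orthonormal basis `u_1, …, u_n` of Z-eigenvectors of `A`, which is in turn
equivalent to the existence of an orthonormal basis with `A·u_i·u_i·u_j = 0` for `i ≠ j`.
Moreover, for such a basis, the matrix `Q_*` with columns `u_1, …, u_n` transforms `A`
into a pseudo diagonal tensor. -/
theorem stmt_3 (n : ℕ) (A : Fin n → Fin n → Fin n → ℝ) (hA : IsSymT n A) :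
    ((∃ Q : Matrix (Fin n) (Fin n) ℝ, Qᵀ * Q = 1 ∧ PseudoDiag n (transform n A Q)) ↔
      (∃ u : Fin n → Fin n → ℝ, OrthonormalFam n u ∧ ∀ i : Fin n, ∃ lam : ℝ,
        ∀ k : Fin n, (∑ p, ∑ q, A p q k * u i p * u i q) = lam * u i k)) ∧
    ((∃ Q : Matrix (Fin n) (Fin n) ℝ, Qᵀ * Q = 1 ∧ PseudoDiag n (transform n A Q)) ↔
      (∃ u : Fin n → Fin n → ℝ, OrthonormalFam n u ∧ ∀ i j : Fin n, i ≠ j →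
        (∑ p, ∑ q, ∑ k, A p q k * u i p * u i q * u j k) = 0)) ∧
    (∀ u : Fin n → Fin n → ℝ, OrthonormalFam n u →
      (∀ i j : Fin n, i ≠ j → (∑ p, ∑ q, ∑ k, A p q k * u i p * u i q * u j k) = 0) →
      PseudoDiag n (transform n A (Matrix.of fun p i => u i p))) := by
  have key : (∃ Q : Matrix (Fin n) (Fin n) ℝ, Qᵀ * Q = 1 ∧ PseudoDiag n (transform n A Q)) ↔
      (∃ u : Fin n → Fin n → ℝ, OrthonormalFam n u ∧ ∀ i j : Fin n, i ≠ j →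
        (∑ p, ∑ q, ∑ k, A p q k * u i p * u i q * u j k) = 0) := by
    constructor
    · rintro ⟨Q, h1, h2⟩
      exact ⟨fun i p => Q p i, (aux_orth n Q).1 h1, (aux_pd n A hA Q).1 h2⟩
    · rintro ⟨u, h1, h2⟩
      exact ⟨Matrix.of fun p i => u i p, (aux_orth n _).2 h1, (aux_pd n A hA _).2 h2⟩
  refine ⟨?_, key, fun u _ h => (aux_pd n A hA _).2 h⟩
  rw [key]
  exact exists_congr fun u => and_congr_right fun hu => (aux_eig n A u hu).symm
end

section
/- Let A ∈ S_n and let u_1, …, u_n be an orthonormal basis of ℝⁿ such that A·u_i·u_i·u_j = 0 for all 1 ≤ i ≠ j ≤ n. Then A is orthogonally decomposable, i.e. A = Σ_{k=1}^n λ_k v_k ⊗ v_k ⊗ v_k for some λ_k ∈ ℝ and some orthonormal basis v_1, …, v_n of ℝⁿ, if and only if for all 1 ≤ i ≠ j ≤ n the vector A·u_i·u_j lies in span{u_i, u_j}. -/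
open scoped BigOperators

/-- `A` is orthogonally decomposable: `A = ∑ k, λ_k v_k ⊗ v_k ⊗ v_k` for an
orthonormal basis `v_1, …, v_n`. -/
def Odeco (n : ℕ) (A : Fin n → Fin n → Fin n → ℝ) : Prop :=
  ∃ lam : Fin n → ℝ, ∃ v : Fin n → Fin n → ℝ, OrthonormalFam n v ∧
    ∀ i j k : Fin n, A i j k = ∑ l, lam l * v l i * v l j * v l k


def BB (n : ℕ) (A : Fin n → Fin n → Fin n → ℝ) (x y : Fin n → ℝ) : Fin n → ℝ :=
  fun k => ∑ p, ∑ q, A p q k * x p * y q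

lemma complete_aux (n : ℕ) (u : Fin n → Fin n → ℝ) (hu : OrthonormalFam n u) (p q : Fin n) :
    ∑ i, u i p * u i q = if p = q then 1 else 0 := by
  have h : (Matrix.of u) * (Matrix.of u).transpose = 1 := by
    ext i j
    simpa [Matrix.mul_apply, Matrix.one_apply] using hu i j
  have h2 := mul_eq_one_comm.mp h
  have h3 := congrFun (congrFun h2 p) q
  simpa [Matrix.mul_apply, Matrix.one_apply] using h3

lemma expand_aux (n : ℕ) (u : Fin n → Fin n → ℝ) (hu : OrthonormalFam n u) (w : Fin n → ℝ)
    (k : Fin n) : w k = ∑ j, u j k * ∑ p, u j p * w p := by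
  simp_rw [Finset.mul_sum]
  rw [Finset.sum_comm]
  have : ∀ p, ∑ j, u j k * (u j p * w p) = (if k = p then 1 else 0) * w p := by
    intro p
    rw [← complete_aux n u hu k p, Finset.sum_mul]
    exact Finset.sum_congr rfl fun j _ => by ring
  simp_rw [this]
  simp

lemma single_aux (n : ℕ) (u : Fin n → Fin n → ℝ) (hu : OrthonormalFam n u) (w : Fin n → ℝ)
    (i : Fin n) (h : ∀ j, i ≠ j → ∑ p, u j p * w p = 0) (k : Fin n) :
    w k = u i k * ∑ p, u i p * w p := by
  refine (expand_aux n u hu w k).trans (Finset.sum_eq_single i ?_ ?_)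
  · intro j _ hj
    rw [h j hj.symm, mul_zero]
  · simp

lemma inner_aux (n : ℕ) (v : Fin n → Fin n → ℝ) (hv : OrthonormalFam n v) (a b : Fin n → ℝ) :
    ∑ k, (∑ l, a l * v l k) * (∑ l, b l * v l k) = ∑ l, a l * b l := by
  simp_rw [Finset.sum_mul_sum]
  rw [Finset.sum_comm]
  refine Finset.sum_congr rfl fun l _ => ?_
  rw [Finset.sum_comm]
  have : ∀ m, ∑ k, a l * v l k * (b m * v m k) = a l * b m * if l = m then 1 else 0 := by
    intro m
    rw [← hv l m, Finset.mul_sum]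
    exact Finset.sum_congr rfl fun j _ => by ring
  simp_rw [this]
  simp

lemma BB_odeco (n : ℕ) (A : Fin n → Fin n → Fin n → ℝ) (lam : Fin n → ℝ) (v : Fin n → Fin n → ℝ)
    (h : ∀ i j k : Fin n, A i j k = ∑ l, lam l * v l i * v l j * v l k) (x y : Fin n → ℝ)
    (k : Fin n) :
    BB n A x y k = ∑ l, (lam l * (∑ p, v l p * x p) * (∑ q, v l q * y q)) * v l k := by
  unfold BB
  simp_rw [h]
  have e : ∀ l, (lam l * (∑ p, v l p * x p) * (∑ q, v l q * y q)) * v l k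
      = ∑ p, ∑ q, lam l * v l p * v l q * v l k * x p * y q := by
    intro l
    rw [mul_assoc (lam l), Finset.sum_mul_sum, Finset.mul_sum, Finset.sum_mul]
    refine Finset.sum_congr rfl fun p _ => ?_
    rw [Finset.mul_sum, Finset.sum_mul]
    exact Finset.sum_congr rfl fun q _ => by ring
  simp_rw [e, Finset.sum_mul]
  symm
  rw [Finset.sum_comm]
  refine Finset.sum_congr rfl fun p _ => ?_
  rw [Finset.sum_comm]

lemma BB_inner (n : ℕ) (A : Fin n → Fin n → Fin n → ℝ) (x y z : Fin n → ℝ) :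
    ∑ k, z k * BB n A x y k = ∑ p, ∑ q, ∑ k, A p q k * x p * y q * z k := by
  unfold BB
  simp_rw [Finset.mul_sum]
  rw [Finset.sum_comm]
  refine Finset.sum_congr rfl fun p _ => ?_
  rw [Finset.sum_comm]
  refine Finset.sum_congr rfl fun q _ => ?_
  refine Finset.sum_congr rfl fun q _ => ?_
  ring

lemma BB_comm (n : ℕ) (A : Fin n → Fin n → Fin n → ℝ) (hA : IsSymT n A) (x y : Fin n → ℝ) :
    BB n A x y = BB n A y x := by
  funext k
  unfold BB
  rw [Finset.sum_comm]
  refine Finset.sum_congr rfl fun p _ => ?_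
  refine Finset.sum_congr rfl fun q _ => ?_
  rw [(hA p q k).1]; ring

lemma BB_symm (n : ℕ) (A : Fin n → Fin n → Fin n → ℝ) (hA : IsSymT n A) (x y z : Fin n → ℝ) :
    ∑ k, z k * BB n A x y k = ∑ k, y k * BB n A x z k := by
  rw [BB_inner, BB_inner]
  refine Finset.sum_congr rfl fun p _ => ?_
  rw [Finset.sum_comm]
  refine Finset.sum_congr rfl fun q _ => ?_
  refine Finset.sum_congr rfl fun k _ => ?_
  rw [(hA p q k).2]; ring

lemma recon_aux (n : ℕ) (A : Fin n → Fin n → Fin n → ℝ)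
    (u : Fin n → Fin n → ℝ) (hu : OrthonormalFam n u) (p q k : Fin n) :
    A p q k = ∑ i, ∑ j, u i p * u j q * BB n A (u i) (u j) k := by
  rw [expand_aux n u hu (fun p => A p q k) p]
  refine Finset.sum_congr rfl fun i _ => ?_
  have : ∀ p', A p' q k = ∑ j, u j q * ∑ q', u j q' * A p' q' k := fun p' =>
    expand_aux n u hu (fun q => A p' q k) q
  simp_rw [this]
  unfold BB
  simp_rw [Finset.mul_sum]
  rw [Finset.sum_comm]
  refine Finset.sum_congr rfl fun j _ => ?_
  refine Finset.sum_congr rfl fun a _ => ?_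
  refine Finset.sum_congr rfl fun b _ => ?_
  ring

/-- Proposition 3.27 / `theorem-z-PD-D`.
Let `A ∈ S_n` and `u_1, …, u_n` be an orthonormal basis with `A·u_i·u_i·u_j = 0` for
all `i ≠ j`. Then `A` is orthogonally decomposable iff for all `i ≠ j` the vector
`A·u_i·u_j` lies in `span {u_i, u_j}`. -/
theorem stmt_4 (n : ℕ) (A : Fin n → Fin n → Fin n → ℝ) (hA : IsSymT n A)
    (u : Fin n → Fin n → ℝ) (hu : OrthonormalFam n u)
    (hZ : ∀ i j : Fin n, i ≠ j → (∑ p, ∑ q, ∑ k, A p q k * u i p * u i q * u j k) = 0) :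
    Odeco n A ↔
      (∀ i j : Fin n, i ≠ j →
        (fun k => ∑ p, ∑ q, A p q k * u i p * u j q) ∈
          Submodule.span ℝ ({u i, u j} : Set (Fin n → ℝ))) := by
  have hw : ∀ i j, i ≠ j → ∑ k, u j k * BB n A (u i) (u i) k = 0 := by
    intro i j hij
    rw [BB_inner]; exact hZ i j hij
  have hw2 : ∀ i k, BB n A (u i) (u i) k = u i k * ∑ p, u i p * BB n A (u i) (u i) p :=
    fun i k => single_aux n u hu _ i (fun j hij => hw i j hij) k
  constructor
  · rintro ⟨lam, v, hv, h⟩ i j hij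
    have h0 : ∑ k, BB n A (u i) (u j) k * BB n A (u i) (u j) k
        = ∑ k, BB n A (u i) (u i) k * BB n A (u j) (u j) k := by
      simp_rw [BB_odeco n A lam v h]
      rw [inner_aux n v hv, inner_aux n v hv]
      exact Finset.sum_congr rfl fun l _ => by ring
    have h1 : ∑ k, BB n A (u i) (u i) k * BB n A (u j) (u j) k = 0 := by
      have : ∀ k, BB n A (u i) (u i) k * BB n A (u j) (u j) k =
          (∑ p, u i p * BB n A (u i) (u i) p) * (u i k * BB n A (u j) (u j) k) := by
        intro k
        rw [hw2 i k]; ring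
      simp_rw [this]
      rw [← Finset.mul_sum, hw j i hij.symm, mul_zero]
    rw [h1, Finset.sum_eq_zero_iff_of_nonneg (fun k _ => mul_self_nonneg _)] at h0
    have h2 : (fun k => ∑ p, ∑ q, A p q k * u i p * u j q) = 0 := by
      funext k
      exact mul_self_eq_zero.mp (h0 k (Finset.mem_univ k))
    rw [h2]
    exact Submodule.zero_mem _
  · intro h
    have h0 : ∀ i j, i ≠ j → ∀ k, BB n A (u i) (u j) k = 0 := by
      intro i j hij
      obtain ⟨a, b, hab⟩ := Submodule.mem_span_pair.mp (h i j hij)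
      change _ = BB n A (u i) (u j) at hab
      have e : ∀ m, ∑ k, u m k * BB n A (u i) (u j) k
          = a * (if m = i then 1 else 0) + b * (if m = j then 1 else 0) := by
        intro m
        rw [← hab, ← hu m i, ← hu m j, Finset.mul_sum, Finset.mul_sum, ← Finset.sum_add_distrib]
        refine Finset.sum_congr rfl fun k _ => ?_
        simp only [Pi.add_apply, Pi.smul_apply, smul_eq_mul]
        ring
      have ei := e i
      have ej := e j
      rw [BB_symm n A hA, hw i j hij] at ei
      rw [BB_comm n A hA, BB_symm n A hA, hw j i hij.symm] at ej
      simp [hij, hij.symm] at ei ej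
      intro k
      rw [← hab, ← ei, ← ej]; simp
    refine ⟨fun i => ∑ p, u i p * BB n A (u i) (u i) p, u, hu, fun p q k => ?_⟩
    rw [recon_aux n A u hu p q k]
    refine Finset.sum_congr rfl fun i _ => ?_
    rw [Finset.sum_eq_single i]
    · rw [hw2 i k]; ring
    · intro j _ hj
      rw [h0 i j hj.symm, mul_zero]
    · simp
end

section
/- Let A ∈ S_3 be Jacobi diagonal and let γ₁₂, γ₁₃, γ₂₃ ∈ ℝ satisfy A_{122} = γ₁₂ A_{111}, A_{112} = γ₁₂ A_{222}, A_{133} = γ₁₃ A_{111}, A_{113} = γ₁₃ A_{333}, A_{233} = γ₂₃ A_{222}, A_{223} = γ₂₃ A_{333}. Write a = A_{111}, b = A_{222}, c = A_{333}, g = A_{123}, and let M_A be the Euclidean Hessian matrix built from these data. Then: if M_A is negative definite, A is locally maximally diagonal (the identity I₃ is a local maximum point of f over SO(3)); and conversely, if A is locally maximally diagonal, then M_A is negative semidefinite. -/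
open scoped BigOperators
open Matrix

/-- The special orthogonal group `SO(n)` as a set of matrices. -/
def SOset (n : ℕ) : Set (Matrix (Fin n) (Fin n) ℝ) :=
  {Q | Qᵀ * Q = 1 ∧ Q.det = 1}


open Asymptotics Filter Topology

abbrev V3 := ℝ × ℝ × ℝ

def Jet (F : V3 → ℝ) (c : ℝ) (l q : V3 → ℝ) : Prop :=
  l =O[𝓝 0] (fun v : V3 => ‖v‖) ∧ q =O[𝓝 0] (fun v : V3 => ‖v‖ ^ 2) ∧
    (fun v => F v - c - l v - q v) =O[𝓝 0] (fun v : V3 => ‖v‖ ^ 3)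

lemma e_one : (fun v : V3 => ‖v‖) =O[𝓝 0] (fun _ : V3 => (1:ℝ)) :=
  (continuous_norm.tendsto (0 : V3)).isBigO_one ℝ

lemma e_succ (k : ℕ) : (fun v : V3 => ‖v‖ ^ (k+1)) =O[𝓝 0] (fun v : V3 => ‖v‖ ^ k) := by
  simpa [pow_succ] using (isBigO_refl (fun v : V3 => ‖v‖ ^ k) (𝓝 0)).mul e_one

lemma e_pow_one (k : ℕ) : (fun v : V3 => ‖v‖ ^ k) =O[𝓝 0] (fun _ : V3 => (1:ℝ)) := by
  simpa using e_one.pow k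

lemma Jet.congr {F c l q F' c' l' q'} (h : Jet F c l q) (h1 : ∀ v, F' v = F v) (h2 : c' = c)
    (h3 : ∀ v, l' v = l v) (h4 : ∀ v, q' v = q v) : Jet F' c' l' q' := by
  obtain rfl : F' = F := funext h1
  obtain rfl : l' = l := funext h3
  obtain rfl : q' = q := funext h4
  rw [h2]; exact h

lemma Jet.add {F c l q F' c' l' q'} (h : Jet F c l q) (h' : Jet F' c' l' q') :
    Jet (fun v => F v + F' v) (c + c') (fun v => l v + l' v) (fun v => q v + q' v) := by
  refine ⟨h.1.add h'.1, h.2.1.add h'.2.1, ?_⟩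
  refine (h.2.2.add h'.2.2).congr_left fun v => ?_
  ring

lemma Jet.const (k : ℝ) : Jet (fun _ => k) k (fun _ => 0) (fun _ => 0) :=
  ⟨isBigO_zero _ _, isBigO_zero _ _, by simpa using isBigO_zero _ _⟩

lemma Jet.mul {F c l q F' c' l' q'} (h : Jet F c l q) (h' : Jet F' c' l' q') :
    Jet (fun v => F v * F' v) (c * c') (fun v => c * l' v + c' * l v)
      (fun v => c * q' v + l v * l' v + c' * q v) := by
  obtain ⟨hl, hq, hr⟩ := h
  obtain ⟨hl', hq', hr'⟩ := h'
  have L1 := hl.trans e_one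
  have L1' := hl'.trans e_one
  have Q1 := hq.trans (e_pow_one 2)
  have Q1' := hq'.trans (e_pow_one 2)
  have C : ∀ k : ℝ, (fun _ : V3 => k) =O[𝓝 0] (fun _ : V3 => (1:ℝ)) :=
    fun k => isBigO_const_const _ one_ne_zero _
  have G1 := ((C c').add L1').add Q1'
  have F1 : F =O[𝓝 0] (fun _ : V3 => (1:ℝ)) := by
    refine ((((C c).add L1).add Q1).add (hr.trans (e_pow_one 3))).congr_left fun v => ?_
    ring
  refine ⟨(hl'.const_mul_left c).add (hl.const_mul_left c'), ?_, ?_⟩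
  · refine ((hq'.const_mul_left c).add ?_).add (hq.const_mul_left c')
    simpa [pow_two] using hl.mul hl'
  · have t1 := F1.mul hr'
    have t2 := hr.mul G1
    have t3 := hl.mul hq'
    have t4 := hq.mul hl'
    have t5 := (Q1.mul hq').congr_left (f₂ := fun v => q v * q' v) (fun _ => rfl)
    have t5 : (fun v => q v * q' v) =O[𝓝 0] (fun v : V3 => ‖v‖ ^ 3) := by
      refine (hq.mul hq').trans ?_
      refine (e_succ 3).congr_left fun v => ?_
      ring
    simp only [one_mul, mul_one] at t1 t2
    have t3 : (fun v => l v * q' v) =O[𝓝 0] (fun v : V3 => ‖v‖ ^ 3) :=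
      t3.congr_right fun v => by ring
    have t4 : (fun v => q v * l' v) =O[𝓝 0] (fun v : V3 => ‖v‖ ^ 3) :=
      t4.congr_right fun v => by ring
    refine ((((t1.add t2).add t3).add t4).add t5).congr_left fun v => ?_
    ring

lemma Jet.cmul {F c l q} (k : ℝ) (h : Jet F c l q) :
    Jet (fun v => k * F v) (k * c) (fun v => k * l v) (fun v => k * q v) :=
  ((Jet.const k).mul h).congr (fun _ => rfl) rfl (fun v => by ring) (fun v => by ring)

lemma jet_x : Jet (fun v => v.1) 0 (fun v => v.1) (fun _ => 0) :=
  ⟨IsBigO.of_bound 1 (Eventually.of_forall fun v => by simpa using norm_fst_le v),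
    isBigO_zero _ _, by simpa using isBigO_zero _ _⟩
lemma jet_y : Jet (fun v => v.2.1) 0 (fun v => v.2.1) (fun _ => 0) :=
  ⟨IsBigO.of_bound 1 (Eventually.of_forall fun v => by
      simpa using (norm_fst_le v.2).trans (norm_snd_le v)),
    isBigO_zero _ _, by simpa using isBigO_zero _ _⟩
lemma jet_z : Jet (fun v => v.2.2) 0 (fun v => v.2.2) (fun _ => 0) :=
  ⟨IsBigO.of_bound 1 (Eventually.of_forall fun v => by
      simpa using (norm_snd_le v.2).trans (norm_snd_le v)),
    isBigO_zero _ _, by simpa using isBigO_zero _ _⟩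

def cub (a b c d e f h i j g u v w : ℝ) : ℝ :=
  a*(u*u*u) + b*(v*v*v) + c*(w*w*w) + 3*d*(u*u*v) + 3*e*(u*v*v) + 3*f*(u*u*w) + 3*h*(u*w*w)
    + 3*i*(v*v*w) + 3*j*(v*w*w) + 6*g*(u*v*w)

lemma jet_cub (a b c d e f h i j g : ℝ) {u v w q0 l1 q1 l2 q2}
    (hu : Jet u 1 (fun _ => 0) q0) (hv : Jet v 0 l1 q1) (hw : Jet w 0 l2 q2) :
    Jet (fun t => cub a b c d e f h i j g (u t) (v t) (w t)) a
      (fun t => 3*d*l1 t + 3*f*l2 t)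
      (fun t => 3*a*q0 t + 3*d*q1 t + 3*f*q2 t + 3*e*l1 t^2 + 3*h*l2 t^2 + 6*g*l1 t*l2 t) := by
  have K := ((((((((((hu.mul hu).mul hu).cmul a).add (((hv.mul hv).mul hv).cmul b)).add
    (((hw.mul hw).mul hw).cmul c)).add (((hu.mul hu).mul hv).cmul (3*d))).add
    (((hu.mul hv).mul hv).cmul (3*e))).add (((hu.mul hu).mul hw).cmul (3*f))).add
    (((hu.mul hw).mul hw).cmul (3*h))).add (((hv.mul hv).mul hw).cmul (3*i))).add
    (((hv.mul hw).mul hw).cmul (3*j)) |>.add (((hu.mul hv).mul hw).cmul (6*g))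
  refine K.congr (fun t => ?_) ?_ (fun t => ?_) (fun t => ?_)
  · simp only [cub]
  · ring
  · ring
  · ring

def Rm (v : V3) : Matrix (Fin 3) (Fin 3) ℝ :=
  !![1 + (v.1*v.1 - v.2.1*v.2.1 - v.2.2*v.2.2), 2*(v.1*v.2.1 - v.2.2), 2*(v.1*v.2.2 + v.2.1);
     2*(v.1*v.2.1 + v.2.2), 1 + (v.2.1*v.2.1 - v.1*v.1 - v.2.2*v.2.2), 2*(v.2.1*v.2.2 - v.1);
     2*(v.1*v.2.2 - v.2.1), 2*(v.2.1*v.2.2 + v.1), 1 + (v.2.2*v.2.2 - v.1*v.1 - v.2.1*v.2.1)]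

def Nm (v : V3) : ℝ := 1 + (v.1*v.1 + v.2.1*v.2.1 + v.2.2*v.2.2)

lemma jet_diag {f g h : V3 → ℝ} {l1 l2 l3} (h1 : Jet f 0 l1 fun _ => 0)
    (h2 : Jet g 0 l2 fun _ => 0) (h3 : Jet h 0 l3 fun _ => 0) (s t r : ℝ) :
    Jet (fun v => 1 + (s * (f v * f v) + t * (g v * g v) + r * (h v * h v))) 1 (fun _ => 0)
      (fun v => s * (l1 v * l1 v) + t * (l2 v * l2 v) + r * (l3 v * l3 v)) := by
  refine ((Jet.const 1).add ((((h1.mul h1).cmul s).add ((h2.mul h2).cmul t)).add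
    ((h3.mul h3).cmul r))).congr (fun v => rfl) ?_ (fun v => ?_) (fun v => ?_) <;> ring

lemma jet_off {f g h : V3 → ℝ} {l1 l2 l3} (h1 : Jet f 0 l1 fun _ => 0)
    (h2 : Jet g 0 l2 fun _ => 0) (h3 : Jet h 0 l3 fun _ => 0) (s : ℝ) :
    Jet (fun v => 2 * (f v * g v + s * h v)) 0 (fun v => 2 * s * l3 v)
      (fun v => 2 * (l1 v * l2 v)) := by
  refine (((h1.mul h2).add (h3.cmul s)).cmul 2).congr (fun v => rfl) ?_ (fun v => ?_)
    (fun v => ?_) <;> ring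

lemma transform_smul (A) (s : ℝ) (Q : Matrix (Fin 3) (Fin 3) ℝ) (i : Fin 3) :
    transform 3 A (s • Q) i i i = s ^ 3 * transform 3 A Q i i i := by
  simp only [transform, Finset.mul_sum, Matrix.smul_apply, smul_eq_mul]
  refine Finset.sum_congr rfl fun p _ => Finset.sum_congr rfl fun q _ =>
    Finset.sum_congr rfl fun r _ => ?_
  ring

lemma fObj_smul (A) (s : ℝ) (Q : Matrix (Fin 3) (Fin 3) ℝ) :
    fObj 3 A (s • Q) = s ^ 6 * fObj 3 A Q := by
  simp only [fObj, transform_smul, Finset.mul_sum]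
  refine Finset.sum_congr rfl fun p _ => ?_
  ring

lemma transform_cub (A) (hA : IsSymT 3 A) (Q : Matrix (Fin 3) (Fin 3) ℝ) (i : Fin 3) :
    transform 3 A Q i i i = cub (A 0 0 0) (A 1 1 1) (A 2 2 2) (A 0 0 1) (A 0 1 1) (A 0 0 2)
      (A 0 2 2) (A 1 1 2) (A 1 2 2) (A 0 1 2) (Q 0 i) (Q 1 i) (Q 2 i) := by
  have e1 : A 0 1 0 = A 0 0 1 := (hA 0 1 0).2
  have e2 : A 1 0 0 = A 0 0 1 := (hA 1 0 0).1.trans e1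
  have e3 : A 1 0 1 = A 0 1 1 := (hA 1 0 1).1
  have e4 : A 1 1 0 = A 0 1 1 := (hA 1 1 0).2.trans e3
  have e5 : A 0 2 0 = A 0 0 2 := (hA 0 2 0).2
  have e6 : A 2 0 0 = A 0 0 2 := (hA 2 0 0).1.trans e5
  have e7 : A 2 0 2 = A 0 2 2 := (hA 2 0 2).1
  have e8 : A 2 2 0 = A 0 2 2 := (hA 2 2 0).2.trans e7
  have e9 : A 1 2 1 = A 1 1 2 := (hA 1 2 1).2
  have e10 : A 2 1 1 = A 1 1 2 := (hA 2 1 1).1.trans e9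
  have e11 : A 2 1 2 = A 1 2 2 := (hA 2 1 2).1
  have e12 : A 2 2 1 = A 1 2 2 := (hA 2 2 1).2.trans e11
  have f1 : A 0 2 1 = A 0 1 2 := (hA 0 2 1).2
  have f2 : A 1 0 2 = A 0 1 2 := (hA 1 0 2).1
  have f3 : A 1 2 0 = A 0 1 2 := (hA 1 2 0).2.trans f2
  have f4 : A 2 0 1 = A 0 1 2 := (hA 2 0 1).1.trans f1
  have f5 : A 2 1 0 = A 0 1 2 := (hA 2 1 0).2.trans f4
  simp only [transform, Fin.sum_univ_three, e1,e2,e3,e4,e5,e6,e7,e8,e9,e10,e11,e12,f1,f2,f3,f4,f5,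
    cub]
  ring

lemma cub_perm1 (a b c d e f h i j g u v w : ℝ) :
    cub a b c d e f h i j g u v w = cub b a c e d i j f h g v u w := by
  simp only [cub]; ring

lemma cub_perm2 (a b c d e f h i j g u v w : ℝ) :
    cub a b c d e f h i j g u v w = cub c b a j i h f e d g w v u := by
  simp only [cub]; ring

def qf (a b c g p q r : ℝ) (v : V3) : ℝ :=
  (3*p^2 + 2*p - 1) * (a^2 + b^2) * v.2.2^2 + (3*q^2 + 2*q - 1) * (c^2 + a^2) * v.2.1^2
   + (3*r^2 + 2*r - 1) * (b^2 + c^2) * v.1^2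
   - 2 * (2*g*a + (3*p*q - r) * b * c) * v.2.2 * v.2.1
   + 2 * (-(2*g*b) - (3*r*p - q) * c * a) * v.2.2 * v.1
   - 2 * (2*g*c + (3*q*r - p) * a * b) * v.2.1 * v.1

lemma key (A) (hA : IsSymT 3 A) (p q r : ℝ)
    (h12a : A 0 1 1 = p * A 0 0 0) (h12b : A 0 0 1 = p * A 1 1 1)
    (h13a : A 0 2 2 = q * A 0 0 0) (h13b : A 0 0 2 = q * A 2 2 2)
    (h23a : A 1 2 2 = r * A 1 1 1) (h23b : A 1 1 2 = r * A 2 2 2) :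
    (fun v => fObj 3 A (Rm v) - Nm v ^ 6 * fObj 3 A 1
      - 12 * qf (A 0 0 0) (A 1 1 1) (A 2 2 2) (A 0 1 2) p q r v) =O[𝓝 0]
      (fun v : V3 => ‖v‖ ^ 3) := by
  have f1 : fObj 3 A 1 = A 0 0 0 ^ 2 + A 1 1 1 ^ 2 + A 2 2 2 ^ 2 := by
    simp [fObj, transform, Fin.sum_univ_three, Matrix.one_apply]
  have W0 : Jet (fun v => transform 3 A (Rm v) 0 0 0) _ _ _ :=
    (jet_cub (A 0 0 0) (A 1 1 1) (A 2 2 2) (A 0 0 1) (A 0 1 1) (A 0 0 2)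
      (A 0 2 2) (A 1 1 2) (A 1 2 2) (A 0 1 2) (jet_diag jet_x jet_y jet_z 1 (-1) (-1))
      (jet_off jet_x jet_y jet_z 1) (jet_off jet_x jet_z jet_y (-1))).congr
      (fun v => by rw [transform_cub A hA]; congr 1 <;> simp [Rm] <;> ring)
      rfl (fun _ => rfl) (fun _ => rfl)
  have W1 : Jet (fun v => transform 3 A (Rm v) 1 1 1) _ _ _ :=
    (jet_cub (A 1 1 1) (A 0 0 0) (A 2 2 2) (A 0 1 1) (A 0 0 1) (A 1 1 2)
      (A 1 2 2) (A 0 0 2) (A 0 2 2) (A 0 1 2) (jet_diag jet_x jet_y jet_z (-1) 1 (-1))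
      (jet_off jet_x jet_y jet_z (-1)) (jet_off jet_y jet_z jet_x 1)).congr
      (fun v => by rw [transform_cub A hA, cub_perm1]; congr 1 <;> simp [Rm] <;> ring)
      rfl (fun _ => rfl) (fun _ => rfl)
  have W2 : Jet (fun v => transform 3 A (Rm v) 2 2 2) _ _ _ :=
    (jet_cub (A 2 2 2) (A 1 1 1) (A 0 0 0) (A 1 2 2) (A 1 1 2) (A 0 2 2)
      (A 0 0 2) (A 0 1 1) (A 0 0 1) (A 0 1 2) (jet_diag jet_x jet_y jet_z (-1) (-1) 1)
      (jet_off jet_y jet_z jet_x (-1)) (jet_off jet_x jet_z jet_y 1)).congr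
      (fun v => by rw [transform_cub A hA, cub_perm2]; congr 1 <;> simp [Rm] <;> ring)
      rfl (fun _ => rfl) (fun _ => rfl)
  have N1 : Jet Nm 1 (fun _ => 0) (fun v => v.1*v.1 + v.2.1*v.2.1 + v.2.2*v.2.2) :=
    (jet_diag jet_x jet_y jet_z 1 1 1).congr (fun v => by simp [Nm]) rfl (fun _ => rfl)
      (fun v => by ring)
  have N3 := (N1.mul N1).mul N1
  have N6 := (N3.mul N3).cmul (-fObj 3 A 1)
  have T := (((W0.mul W0).add (W1.mul W1)).add (W2.mul W2)).add N6
  refine T.2.2.congr_left fun v => ?_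
  simp only [f1]
  simp only [h12a, h12b, h13a, h13b, h23a, h23b, qf, fObj, Fin.sum_univ_three]
  ring

lemma Rm_so (v : V3) : (Nm v)⁻¹ • Rm v ∈ SOset 3 := by
  have hN : Nm v ≠ 0 := by
    have : 0 < Nm v := by unfold Nm; nlinarith [sq_nonneg v.1, sq_nonneg v.2.1, sq_nonneg v.2.2]
    exact this.ne'
  have h1 : (Rm v)ᵀ * Rm v = (Nm v ^ 2) • (1 : Matrix (Fin 3) (Fin 3) ℝ) := by
    ext i j
    fin_cases i <;> fin_cases j <;> simp [Rm, Nm, Matrix.mul_apply, Fin.sum_univ_three] <;> ring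
  have h2 : (Rm v).det = Nm v ^ 3 := by
    simp [Rm, Nm, Matrix.det_fin_three]; ring
  refine ⟨?_, ?_⟩
  · rw [Matrix.transpose_smul, Matrix.smul_mul, Matrix.mul_smul, h1, smul_smul, smul_smul]
    rw [show (Nm v)⁻¹ * (Nm v)⁻¹ * Nm v ^ 2 = 1 by field_simp, one_smul]
  · rw [Matrix.det_smul, h2]; simp; field_simp

noncomputable def vq (Q : Matrix (Fin 3) (Fin 3) ℝ) : V3 :=
  ((Q 2 1 - Q 1 2) / (1 + Q 0 0 + Q 1 1 + Q 2 2), (Q 0 2 - Q 2 0) / (1 + Q 0 0 + Q 1 1 + Q 2 2),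
    (Q 1 0 - Q 0 1) / (1 + Q 0 0 + Q 1 1 + Q 2 2))

lemma vq_spec (Q : Matrix (Fin 3) (Fin 3) ℝ) (hQ : Q ∈ SOset 3)
    (hs : 1 + Q 0 0 + Q 1 1 + Q 2 2 ≠ 0) : Rm (vq Q) = Nm (vq Q) • Q := by
  obtain ⟨h1, h2⟩ := hQ
  have h3 : Q * Qᵀ = 1 := mul_eq_one_comm.mp h1
  have h4 : Qᵀ = Q.adjugate := by
    have : Q * Q.adjugate = 1 := by rw [Matrix.mul_adjugate, h2, one_smul]
    calc Qᵀ = Qᵀ * (Q * Q.adjugate) := by rw [this, mul_one]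
      _ = Q.adjugate := by rw [← mul_assoc, h1, one_mul]
  rw [Matrix.adjugate_fin_three] at h4
  have c := fun i j => congrFun (congrFun h4 i) j
  have o := fun i j => congrFun (congrFun h1 i) j
  have u := fun i j => congrFun (congrFun h3 i) j
  have c00 := c 0 0; have c01 := c 0 1; have c02 := c 0 2
  have c10 := c 1 0; have c11 := c 1 1; have c12 := c 1 2
  have c20 := c 2 0; have c21 := c 2 1; have c22 := c 2 2
  have o00 := o 0 0; have o01 := o 0 1; have o02 := o 0 2
  have o11 := o 1 1; have o12 := o 1 2; have o22 := o 2 2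
  have u00 := u 0 0; have u01 := u 0 1; have u02 := u 0 2
  have u11 := u 1 1; have u12 := u 1 2; have u22 := u 2 2
  clear c o u h1 h2 h3 h4
  simp [Matrix.mul_apply, Fin.sum_univ_three] at *
  have hN : Nm (vq Q) = 4 / (1 + Q 0 0 + Q 1 1 + Q 2 2) := by
    simp only [Nm, vq]
    field_simp
    linarith
  rw [hN]
  ext i j
  fin_cases i <;> fin_cases j <;> simp [Rm, vq] <;> field_simp <;> linarith

lemma Nm_pos (v : V3) : 0 < Nm v := by
  unfold Nm; nlinarith [sq_nonneg v.1, sq_nonneg v.2.1, sq_nonneg v.2.2]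

lemma quad_bound (F : V3 → ℝ) (hc : Continuous F) (hh : ∀ (t : ℝ) v, F (t • v) = t ^ 2 * F v)
    (hn : ∀ v, v ≠ 0 → F v < 0) : ∃ m > 0, ∀ v, F v ≤ -m * ‖v‖ ^ 2 := by
  obtain ⟨w, hw, hmax⟩ := (isCompact_sphere (0 : V3) 1).exists_isMaxOn
    (NormedSpace.sphere_nonempty.mpr zero_le_one) hc.continuousOn
  have hw1 : ‖w‖ = 1 := by simpa using hw
  have hw0 : w ≠ 0 := by rintro rfl; simp at hw1
  refine ⟨-F w, by linarith [hn w hw0], fun v => ?_⟩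
  by_cases hv : v = 0
  · subst hv
    have := hh 0 0
    simp at this ⊢
    simp [this]
  · have hv' : ‖v‖ ≠ 0 := norm_ne_zero_iff.mpr hv
    have h1 : F (‖v‖⁻¹ • v) ≤ F w := hmax (by simp [norm_smul, hv'])
    have h2 : F v = ‖v‖ ^ 2 * F (‖v‖⁻¹ • v) := by
      rw [← hh, smul_smul, mul_inv_cancel₀ hv', one_smul]
    rw [h2]
    nlinarith [sq_nonneg ‖v‖]

lemma vq_tendsto : Tendsto vq (𝓝[SOset 3] 1) (𝓝 0) := by
  have h : ContinuousAt vq 1 := by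
    unfold vq
    have e : ∀ i j, Continuous fun Q : Matrix (Fin 3) (Fin 3) ℝ => Q i j :=
      fun i j => continuous_id.matrix_elem i j
    have d : ContinuousAt (fun Q : Matrix (Fin 3) (Fin 3) ℝ => 1 + Q 0 0 + Q 1 1 + Q 2 2) 1 :=
      (((continuous_const.add (e 0 0)).add (e 1 1)).add (e 2 2)).continuousAt
    have k : (1 + (1 : Matrix (Fin 3) (Fin 3) ℝ) 0 0 + (1 : Matrix (Fin 3) (Fin 3) ℝ) 1 1
      + (1 : Matrix (Fin 3) (Fin 3) ℝ) 2 2) ≠ 0 := by simp; norm_num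
    exact (((e 2 1).sub (e 1 2)).continuousAt.div d k).prodMk
      ((((e 0 2).sub (e 2 0)).continuousAt.div d k).prodMk
        (((e 1 0).sub (e 0 1)).continuousAt.div d k))
  have h0 : vq 1 = 0 := by simp [vq]
  have := h.tendsto
  rw [h0] at this
  exact this.mono_left nhdsWithin_le_nhds

lemma s_ne : ∀ᶠ Q in 𝓝[SOset 3] (1 : Matrix (Fin 3) (Fin 3) ℝ),
    1 + Q 0 0 + Q 1 1 + Q 2 2 ≠ 0 := by
  have e : ∀ i j, Continuous fun Q : Matrix (Fin 3) (Fin 3) ℝ => Q i j :=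
    fun i j => continuous_id.matrix_elem i j
  have d : ContinuousAt (fun Q : Matrix (Fin 3) (Fin 3) ℝ => 1 + Q 0 0 + Q 1 1 + Q 2 2) 1 :=
    (((continuous_const.add (e 0 0)).add (e 1 1)).add (e 2 2)).continuousAt
  have k : (1 + (1 : Matrix (Fin 3) (Fin 3) ℝ) 0 0 + (1 : Matrix (Fin 3) (Fin 3) ℝ) 1 1
      + (1 : Matrix (Fin 3) (Fin 3) ℝ) 2 2) ≠ 0 := by simp; norm_num
  exact nhdsWithin_le_nhds (d.eventually_ne k)

lemma Rm_tendsto : Tendsto (fun v => (Nm v)⁻¹ • Rm v) (𝓝 0) (𝓝[SOset 3] 1) := by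
  refine tendsto_nhdsWithin_iff.mpr ⟨?_, Eventually.of_forall Rm_so⟩
  have h1 : Continuous fun v => (Nm v)⁻¹ • Rm v := by
    have hN : Continuous Nm := by unfold Nm; fun_prop
    refine (hN.inv₀ fun v => (Nm_pos v).ne').smul ?_
    refine continuous_matrix fun i j => ?_
    fin_cases i <;> fin_cases j <;> simp [Rm] <;> fun_prop
  have h2 : (Nm 0)⁻¹ • Rm 0 = 1 := by
    ext i j
    fin_cases i <;> fin_cases j <;> simp [Rm, Nm]
  have := h1.tendsto 0
  rwa [h2] at this

lemma qf_cont (a b c g p q r : ℝ) : Continuous (qf a b c g p q r) := by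
  unfold qf; fun_prop

lemma qf_hom (a b c g p q r t : ℝ) (v : V3) :
    qf a b c g p q r (t • v) = t ^ 2 * qf a b c g p q r v := by
  simp only [qf, Prod.smul_fst, Prod.smul_snd, smul_eq_mul]; ring

/-- Theorem 4.4 / `theorem-JD-LMD`.
Let `A ∈ S_3` be Jacobi diagonal, with stationary diagonal ratios `γ₁₂, γ₁₃, γ₂₃` and
`a = A_{111}`, `b = A_{222}`, `c = A_{333}`, `g = A_{123}`, and let `M_A` be the
Euclidean Hessian matrix. If `M_A` is negative definite then `A` is locally maximally
diagonal; and if `A` is locally maximally diagonal then `M_A` is negative semidefinite. -/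
theorem stmt_6 (A : Fin 3 → Fin 3 → Fin 3 → ℝ) (hA : IsSymT 3 A)
    (hJD : ∀ i j : Fin 3, i < j →
      ∀ θ : ℝ, fObj 3 A (givens 3 i j θ) ≤ fObj 3 A (givens 3 i j 0))
    (γ12 γ13 γ23 : ℝ)
    (h12a : A 0 1 1 = γ12 * A 0 0 0) (h12b : A 0 0 1 = γ12 * A 1 1 1)
    (h13a : A 0 2 2 = γ13 * A 0 0 0) (h13b : A 0 0 2 = γ13 * A 2 2 2)
    (h23a : A 1 2 2 = γ23 * A 1 1 1) (h23b : A 1 1 2 = γ23 * A 2 2 2)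
    (a b c g : ℝ)
    (ha : a = A 0 0 0) (hb : b = A 1 1 1) (hc : c = A 2 2 2) (hg : g = A 0 1 2)
    (M : Matrix (Fin 3) (Fin 3) ℝ)
    (hM : M = !![(3*γ12^2 + 2*γ12 - 1) * (a^2 + b^2),
                 2*g*a + (3*γ12*γ13 - γ23) * b * c,
                 -(2*g*b) - (3*γ23*γ12 - γ13) * c * a;
                 2*g*a + (3*γ12*γ13 - γ23) * b * c,
                 (3*γ13^2 + 2*γ13 - 1) * (c^2 + a^2),
                 2*g*c + (3*γ13*γ23 - γ12) * a * b;
                 -(2*g*b) - (3*γ23*γ12 - γ13) * c * a,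
                 2*g*c + (3*γ13*γ23 - γ12) * a * b,
                 (3*γ23^2 + 2*γ23 - 1) * (b^2 + c^2)]) :
    ((-M).PosDef → IsLocalMaxOn (fObj 3 A) (SOset 3) 1) ∧
    (IsLocalMaxOn (fObj 3 A) (SOset 3) 1 → (-M).PosSemidef) := by
  have K := key A hA γ12 γ13 γ23 h12a h12b h13a h13b h23a h23b
  rw [← ha, ← hb, ← hc, ← hg] at K
  obtain ⟨C, hC0, hC⟩ := K.exists_pos
  have hC := hC.bound
  have hqf : ∀ w : Fin 3 → ℝ, star w ⬝ᵥ ((-M) *ᵥ w)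
      = - qf a b c g γ12 γ13 γ23 (w 2, -w 1, w 0) := by
    intro w
    rw [hM]
    simp [dotProduct, Matrix.mulVec, Fin.sum_univ_three, qf]
    ring
  constructor
  · intro hP
    obtain ⟨m, hm, hb⟩ := quad_bound (qf a b c g γ12 γ13 γ23) (qf_cont _ _ _ _ _ _ _)
      (qf_hom _ _ _ _ _ _ _) (by
        intro v hv
        have h := hP.dotProduct_mulVec_pos (x := ![v.2.2, -v.2.1, v.1]) (by
          intro h0
          apply hv
          have a0 := congrFun h0 0
          have a1 := congrFun h0 1
          have a2 := congrFun h0 2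
          simp at a0 a1 a2
          ext <;> simp [a0, a1, a2])
        rw [hqf] at h
        simp at h
        exact h)
    have hsmall : ∀ᶠ v : V3 in 𝓝 0, C * ‖v‖ ≤ 12 * m := by
      have : Tendsto (fun v : V3 => C * ‖v‖) (𝓝 0) (𝓝 (C * ‖(0 : V3)‖)) :=
        (continuous_const.mul continuous_norm).tendsto 0
      rw [norm_zero, mul_zero] at this
      exact this.eventually_le_const (by positivity)
    filter_upwards [vq_tendsto.eventually hC, vq_tendsto.eventually hsmall, s_ne,
      self_mem_nhdsWithin] with Q h1 h2 h3 h4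
    rw [vq_spec Q h4 h3, fObj_smul] at h1
    have hN := pow_pos (Nm_pos (vq Q)) 6
    have h5 := hb (vq Q)
    have h6 := (le_abs_self _).trans h1
    rw [Real.norm_of_nonneg (by positivity)] at h6
    have h7 : C * ‖vq Q‖ ^ 3 ≤ 12 * m * ‖vq Q‖ ^ 2 := by
      have := mul_le_mul_of_nonneg_right h2 (sq_nonneg ‖vq Q‖)
      nlinarith
    have h8 : Nm (vq Q) ^ 6 * fObj 3 A Q ≤ Nm (vq Q) ^ 6 * fObj 3 A 1 := by linarith
    exact le_of_mul_le_mul_left h8 hN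
  · intro hL
    refine Matrix.PosSemidef.of_dotProduct_mulVec_nonneg ?_ fun w => ?_
    · rw [hM]
      ext i j
      fin_cases i <;> fin_cases j <;> simp
    rw [hqf]
    generalize ((w 2, -w 1, w 0) : V3) = u
    by_contra! hcon
    have hpos : 0 < qf a b c g γ12 γ13 γ23 u := by linarith
    have hmax : ∀ᶠ v : V3 in 𝓝 0, fObj 3 A ((Nm v)⁻¹ • Rm v) ≤ fObj 3 A 1 :=
      Rm_tendsto.eventually hL
    have ht : Tendsto (fun t : ℝ => t • u) (𝓝[>] 0) (𝓝 0) := by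
      have : Tendsto (fun t : ℝ => t • u) (𝓝 0) (𝓝 ((0 : ℝ) • u)) :=
        (continuous_id.smul continuous_const).tendsto 0
      rw [zero_smul] at this
      exact this.mono_left nhdsWithin_le_nhds
    have hsmall : ∀ᶠ t : ℝ in 𝓝[>] 0, t * (C * ‖u‖ ^ 3) < 12 * qf a b c g γ12 γ13 γ23 u := by
      have : Tendsto (fun t : ℝ => t * (C * ‖u‖ ^ 3)) (𝓝 0) (𝓝 (0 * (C * ‖u‖ ^ 3))) :=
        (continuous_id.mul continuous_const).tendsto 0
      rw [zero_mul] at this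
      exact nhdsWithin_le_nhds (this.eventually_lt_const (by positivity))
    obtain ⟨t, h1, h2, h3, h4⟩ := ((ht.eventually hC).and ((ht.eventually hmax).and
      (hsmall.and self_mem_nhdsWithin))).exists
    have h4 : 0 < t := h4
    have hN := Nm_pos (t • u)
    rw [fObj_smul, inv_pow, inv_mul_le_iff₀ (pow_pos hN 6)] at h2
    have h6 := (neg_abs_le _).trans' (neg_le_neg h1)
    rw [Real.norm_of_nonneg (by positivity), qf_hom, norm_smul, Real.norm_of_nonneg h4.le] at h6
    have h7 : t ^ 2 * (t * (C * ‖u‖ ^ 3)) < t ^ 2 * (12 * qf a b c g γ12 γ13 γ23 u) :=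
      mul_lt_mul_of_pos_left h3 (by positivity)
    nlinarith
end

section
/- Let A ∈ S_4 be the symmetric tensor with A_{ijk} = 1 if i = j = k, A_{ijk} = 3/4 if i, j, k are pairwise distinct, and A_{ijk} = 0 otherwise. Then for every triple 1 ≤ i < j < k ≤ 4, the 3-dimensional subtensor A^{(i,j,k)} (obtained by restricting all three indices of A to {i, j, k}) is locally maximally diagonal in S_3, yet A itself is not locally maximally diagonal in S_4, i.e. the identity I₄ is not a local maximum point of f over SO(4). -/
open scoped BigOperators
open Matrix

/-- The tensor of Example 4.6: `A_{ijk} = 1` if `i = j = k`, `3/4` if `i, j, k` are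
pairwise distinct, and `0` otherwise. -/
noncomputable def exTensor4 : Fin 4 → Fin 4 → Fin 4 → ℝ :=
  fun i j k =>
    if i = j ∧ j = k then 1
    else if i ≠ j ∧ j ≠ k ∧ i ≠ k then 3/4
    else 0

open Filter Topology

lemma aux_qf (a b c d e g : ℝ) :
    (1/2) * (a^2+b^2+c^2+d^2+e^2+g^2) ≤ 3 * (a^2+b^2+c^2+d^2+e^2+g^2) - 9*(b*d+a*g+c*e)
      + 100*((a+b)^2+(c+d)^2+(e+g)^2) := by
  linarith [sq_nonneg ((1)*a + (40/41)*b + (0)*c + (0)*d + (0)*e + (-9/205)*g), sq_nonneg ((1)*b + (0)*c + (-41/45)*d + (0)*e + (8/9)*g), sq_nonneg ((1)*c + (40/41)*d + (-9/205)*e + (0)*g), sq_nonneg ((1)*d + (225/43)*e + (205/43)*g), sq_nonneg ((1)*e + (2125/2132)*g), sq_nonneg ((1)*g)]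

lemma aux_col (x y z : ℝ) (h : x^2+y^2+z^2 = 1) (hx : |x-1| < 1/100) (hy : |y| < 1/100)
    (hz : |z| < 1/100) :
    (x^3+y^3+z^3+9/2*(x*y*z))^2 ≤ 1 - 3*(y^2+z^2) + 9*(y*z) + (1/4)*(y^2+z^2) := by
  rw [abs_lt] at hx hy hz
  obtain ⟨r, hr⟩ : ∃ r, r = y^2+z^2 := ⟨_, rfl⟩
  obtain ⟨m, hm⟩ : ∃ m, m = -r + 9/2*(y*z) := ⟨_, rfl⟩
  obtain ⟨u, hu⟩ : ∃ u, u = y^3+z^3 := ⟨_, rfl⟩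
  have hr0 : 0 ≤ r := by rw [hr]; positivity
  have hr1 : r ≤ 1/1000 := by rw [hr]; nlinarith
  have hm1 : m ≤ 5/4*r := by rw [hm, hr]; nlinarith [sq_nonneg (y-z)]
  have hm2 : -(13/4)*r ≤ m := by rw [hm, hr]; nlinarith [sq_nonneg (y+z)]
  have hu1 : u ≤ 1/100*r := by
    rw [hu, hr]; nlinarith [mul_nonneg (sq_nonneg y) (by linarith : 0 ≤ 1/100 - y), mul_nonneg (sq_nonneg z) (by linarith : 0 ≤ 1/100 - z)]
  have hu2 : -(1/100)*r ≤ u := by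
    rw [hu, hr]; nlinarith [mul_nonneg (sq_nonneg y) (by linarith : 0 ≤ 1/100 + y), mul_nonneg (sq_nonneg z) (by linarith : 0 ≤ 1/100 + z)]
  have hx2 : x^2 = 1 - r := by rw [hr]; linarith
  have hW : x^3+y^3+z^3+9/2*(x*y*z) = x*(1+m)+u := by
    have : x^3 = x*(1-r) := by rw [← hx2]; ring
    rw [this, hm, hu]; ring
  have e1 : (x*(1+m)+u)^2 = (1-r)*(1+m)^2 + 2*(x*(1+m))*u+u^2 := by rw [← hx2]; ring
  have hrr : r*r ≤ 1/1000*r := mul_le_mul_of_nonneg_right hr1 hr0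
  have hm3 : m^2 ≤ 1/50*r := by
    have : m^2 ≤ (13/4*r)^2 := sq_le_sq' (by linarith) (by linarith)
    have e : (13/4*r)^2 = 169/16*(r*r) := by ring
    linarith
  have hrm : -(r*m) ≤ 1/50*r := by
    have := mul_le_mul_of_nonneg_left hm2 hr0
    have e : r*(-(13/4)*r) = -(13/4)*(r*r) := by ring
    linarith
  have hrm2 : 0 ≤ r*m^2 := by positivity
  have hu3 : u^2 ≤ 1/100*r := by
    have : u^2 ≤ (1/100*r)^2 := sq_le_sq' (by linarith) (by linarith)
    have e : (1/100*r)^2 = 1/10000*(r*r) := by ring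
    linarith
  have hp0 : 0 ≤ x*(1+m) := mul_nonneg (by linarith) (by linarith)
  have hp1 : x*(1+m) ≤ 2 := by
    have := mul_le_mul (by linarith : x ≤ 101/100) (by linarith : 1+m ≤ 101/100) (by linarith) (by norm_num)
    linarith
  have hpu : x*(1+m)*u ≤ 1/50*r := by
    have t1 := mul_le_mul_of_nonneg_left hu1 hp0
    have t2 := mul_le_mul_of_nonneg_right hp1 (by linarith : 0 ≤ 1/100*r)
    linarith
  have h9 : 9*(y*z) = 2*m+2*r := by rw [hm]; ring
  rw [hW, e1, h9, ← hr]
  have e2 : (1-r)*(1+m)^2 = 1 + 2*m + m^2 - r - 2*(r*m) - r*m^2 := by ring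
  rw [e2]
  linarith

lemma aux_orth_s8 (p q a b c d : ℝ) (h : p*a+b*q+c*d = 0) (hp : |p-1| < 1/100) (hq : |q-1| < 1/100)
    (hd : |d| < 1/100) : (a+b)^2 ≤ 3/10000*(a^2+b^2+c^2) := by
  rw [abs_lt] at hp hq hd
  have h1 : a+b = (1-p)*a+(1-q)*b - d*c := by linarith
  have h2 : (a+b)^2 ≤ 3*(((1-p)*a)^2+((1-q)*b)^2+(d*c)^2) := by
    rw [h1]
    nlinarith [sq_nonneg ((1-p)*a-(1-q)*b), sq_nonneg ((1-p)*a+d*c), sq_nonneg ((1-q)*b+d*c)]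
  have k1 : (1-p)^2 ≤ 1/10000 := by nlinarith
  have k2 : (1-q)^2 ≤ 1/10000 := by nlinarith
  have k3 : d^2 ≤ 1/10000 := by nlinarith
  nlinarith [mul_le_mul_of_nonneg_right k1 (sq_nonneg a), mul_le_mul_of_nonneg_right k2 (sq_nonneg b),
    mul_le_mul_of_nonneg_right k3 (sq_nonneg c), sq_nonneg a, sq_nonneg b, sq_nonneg c]

noncomputable def auxT : Fin 3 → Fin 3 → Fin 3 → ℝ := fun i j k =>
    if i = j ∧ j = k then 1
    else if i ≠ j ∧ j ≠ k ∧ i ≠ k then 3/4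
    else 0

lemma aux_f3 (Q : Matrix (Fin 3) (Fin 3) ℝ) : fObj 3 auxT Q =
    (Q 0 0^3+Q 1 0^3+Q 2 0^3+9/2*(Q 0 0*Q 1 0*Q 2 0))^2 +
    (Q 1 1^3+Q 0 1^3+Q 2 1^3+9/2*(Q 1 1*Q 0 1*Q 2 1))^2 +
    (Q 2 2^3+Q 0 2^3+Q 1 2^3+9/2*(Q 2 2*Q 0 2*Q 1 2))^2 := by
  simp [fObj, transform, Fin.sum_univ_three, auxT]
  ring

lemma aux_main3 : IsLocalMaxOn (fObj 3 auxT) (SOset 3) 1 := by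
  have hev : ∀ i j : Fin 3, ∀ᶠ Q : Matrix (Fin 3) (Fin 3) ℝ in 𝓝 1,
      |Q i j - (1 : Matrix (Fin 3) (Fin 3) ℝ) i j| < 1/100 := by
    intro i j
    have hc : Continuous fun Q : Matrix (Fin 3) (Fin 3) ℝ =>
        |Q i j - (1 : Matrix (Fin 3) (Fin 3) ℝ) i j| := by fun_prop
    exact hc.continuousAt.eventually_lt continuousAt_const (by norm_num)
  have hev' := eventually_all.2 fun i => eventually_all.2 fun j => hev i j
  show ∀ᶠ Q in 𝓝[SOset 3] 1, fObj 3 auxT Q ≤ fObj 3 auxT 1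
  filter_upwards [mem_nhdsWithin_of_mem_nhds hev', self_mem_nhdsWithin] with Q hQ hS
  have hO := hS.1
  have o : ∀ i j, (Qᵀ * Q) i j = (1 : Matrix (Fin 3) (Fin 3) ℝ) i j := fun i j => by rw [hO]
  have h1 : fObj 3 auxT 1 = 3 := by rw [aux_f3]; simp [Matrix.one_apply]; norm_num
  rw [h1, aux_f3]
  have o00 := o 0 0
  have o11 := o 1 1
  have o22 := o 2 2
  have o01 := o 0 1
  have o02 := o 0 2
  have o12 := o 1 2
  simp [Matrix.mul_apply, Fin.sum_univ_three] at o00 o11 o22 o01 o02 o12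
  have b00 := hQ 0 0
  have b01 := hQ 0 1
  have b02 := hQ 0 2
  have b10 := hQ 1 0
  have b11 := hQ 1 1
  have b12 := hQ 1 2
  have b20 := hQ 2 0
  have b21 := hQ 2 1
  have b22 := hQ 2 2
  simp only [Matrix.one_apply, Fin.isValue, if_true, Fin.reduceEq, if_false, sub_zero] at b00 b01 b02 b10 b11 b12 b20 b21 b22
  have c0 := aux_col (Q 0 0) (Q 1 0) (Q 2 0) (by linarith) b00 b10 b20
  have c1 := aux_col (Q 1 1) (Q 0 1) (Q 2 1) (by linarith) b11 b01 b21
  have c2 := aux_col (Q 2 2) (Q 0 2) (Q 1 2) (by linarith) b22 b02 b12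
  have p0 := aux_orth_s8 (Q 0 0) (Q 1 1) (Q 0 1) (Q 1 0) (Q 2 0) (Q 2 1) (by linarith) b00 b11 b21
  have p1 := aux_orth_s8 (Q 0 0) (Q 2 2) (Q 0 2) (Q 2 0) (Q 1 0) (Q 1 2) (by linarith) b00 b22 b12
  have p2 := aux_orth_s8 (Q 1 1) (Q 2 2) (Q 1 2) (Q 2 1) (Q 0 1) (Q 0 2) (by linarith) b11 b22 b02
  have q := aux_qf (Q 0 1) (Q 1 0) (Q 0 2) (Q 2 0) (Q 1 2) (Q 2 1)
  linarith [sq_nonneg (Q 0 1), sq_nonneg (Q 1 0), sq_nonneg (Q 0 2), sq_nonneg (Q 2 0), sq_nonneg (Q 1 2), sq_nonneg (Q 2 1)]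

noncomputable def auxR (c s : ℝ) : Matrix (Fin 4) (Fin 4) ℝ :=
  !![(1+c)/2, (c-1)/2, -s/2, -s/2;
     (c-1)/2, (1+c)/2, -s/2, -s/2;
     s/2, s/2, (1+c)/2, (c-1)/2;
     s/2, s/2, (c-1)/2, (1+c)/2]

lemma aux_f4 (Q : Matrix (Fin 4) (Fin 4) ℝ) : fObj 4 exTensor4 Q =
    ∑ i, (Q 0 i^3+Q 1 i^3+Q 2 i^3+Q 3 i^3+9/2*(Q 0 i*Q 1 i*Q 2 i+Q 0 i*Q 1 i*Q 3 i
      +Q 0 i*Q 2 i*Q 3 i+Q 1 i*Q 2 i*Q 3 i))^2 := by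
  unfold fObj
  refine Finset.sum_congr rfl fun i _ => ?_
  congr 1
  simp [transform, Fin.sum_univ_four, exTensor4]
  ring

lemma aux_R1 : auxR 1 0 = 1 := by
  ext i j
  fin_cases i <;> fin_cases j <;> simp [auxR]

lemma aux_RSO (c s : ℝ) (h : c^2+s^2 = 1) : auxR c s ∈ SOset 4 := by
  constructor
  · ext i j
    fin_cases i <;> fin_cases j <;>
      simp [auxR, Matrix.mul_apply, Fin.sum_univ_four] <;> linarith
  · have : (auxR c s).det = c^2+s^2 := by
      simp [auxR, Matrix.det_succ_row_zero, Fin.sum_univ_succ, Fin.succAbove]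
      ring
    rw [this, h]

lemma aux_fR (c s : ℝ) (h : c^2+s^2 = 1) :
    fObj 4 exTensor4 (auxR c s) = 4*(1+3/4*s^2-63/64*s^4) := by
  have h4 : fObj 4 exTensor4 (auxR c s) = 4*(c^2*(c^2+15/8*s^2)^2+49/64*s^6)
 := by
    rw [aux_f4]
    simp [auxR, Fin.sum_univ_four]
    have hc : c^2 = 1 - s^2 := by linarith
    grind
  rw [h4]
  have hc : c^2 = 1 - s^2 := by linarith
  rw [hc]; ring

lemma aux_not4 : ¬ IsLocalMaxOn (fObj 4 exTensor4) (SOset 4) 1 := by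
  intro hmax
  have hc : Continuous fun t : ℝ => auxR (Real.cos t) (Real.sin t) := by
    refine continuous_matrix fun i j => ?_
    fin_cases i <;> fin_cases j <;> simp [auxR] <;> fun_prop
  have ht : Tendsto (fun t : ℝ => auxR (Real.cos t) (Real.sin t)) (𝓝 0) (𝓝[SOset 4] 1) := by
    refine tendsto_nhdsWithin_iff.2 ⟨?_, Eventually.of_forall fun t => aux_RSO _ _ (by simp)⟩
    have := hc.tendsto 0
    simpa [aux_R1] using this
  have h1 := ht.eventually hmax
  have h2 : ∀ᶠ t : ℝ in 𝓝[>] 0, fObj 4 exTensor4 (auxR (Real.cos t) (Real.sin t)) ≤ fObj 4 exTensor4 1 :=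
    h1.filter_mono nhdsWithin_le_nhds
  have h3 : ∀ᶠ t : ℝ in 𝓝[>] 0, t ∈ Set.Ioo (0:ℝ) (1/2) := Ioo_mem_nhdsGT (by norm_num)
  obtain ⟨t, ht1, ht2, ht3⟩ := (h2.and h3).exists
  rw [← aux_R1, aux_fR _ _ (by simp), aux_fR _ _ (by simp)] at ht1
  have s0 : 0 < Real.sin t := Real.sin_pos_of_pos_of_lt_pi ht2 (by linarith [Real.pi_gt_three])
  have s1 : Real.sin t < 1/2 := (Real.sin_lt ht2).trans ht3
  have s2 : 0 < Real.sin t^2 := by positivity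
  have s3 : Real.sin t^2 < 1/4 := by nlinarith
  nlinarith

theorem stmt_8 :
    (∀ i j k : Fin 4, i < j → j < k →
      IsLocalMaxOn
        (fObj 3 (fun a b c => exTensor4 (![i, j, k] a) (![i, j, k] b) (![i, j, k] c)))
        (SOset 3) 1) ∧
    ¬ IsLocalMaxOn (fObj 4 exTensor4) (SOset 4) 1 := by
  refine ⟨fun i j k hij hjk => ?_, aux_not4⟩
  have hinj : Function.Injective ![i, j, k] := by
    intro a b hab
    fin_cases a <;> fin_cases b <;> simp at hab ⊢ <;> omega
  have : (fun a b c => exTensor4 (![i, j, k] a) (![i, j, k] b) (![i, j, k] c)) = auxT := by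
    funext a b c
    simp only [exTensor4, auxT, hinj.eq_iff, ne_eq]
  rw [this]
  exact aux_main3
end

section
/- Let n ≥ 2. The orbit of the generally maximally diagonal tensors equals all of S_n, i.e. O(GMD_n) = S_n, if and only if the class of generally maximally diagonal tensors coincides with the class of maximally diagonal tensors, i.e. GMD_n = MD_n. -/
open scoped BigOperators
open Matrix

/-- The objective `F(P,Q,R) = ∑ i, (∑ p q r, A p q r * P p i * Q q i * R r i)²`. -/
def FObj (n : ℕ) (A : Fin n → Fin n → Fin n → ℝ)
    (P Q R : Matrix (Fin n) (Fin n) ℝ) : ℝ :=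
  ∑ i, (∑ p, ∑ q, ∑ r, A p q r * P p i * Q q i * R r i) ^ 2

/-- The maximally diagonal tensors `MD_n`: symmetric tensors for which the identity is a
global maximum point of `f` over `SO(n)`. -/
def MDset (n : ℕ) : Set (Fin n → Fin n → Fin n → ℝ) :=
  {A | IsSymT n A ∧ ∀ Q ∈ SOset n, fObj n A Q ≤ fObj n A 1}

/-- The generally maximally diagonal tensors `GMD_n`: symmetric tensors for which
`(I, I, I)` is a global maximum point of `F` over `SO(n)³`. -/
def GMDset (n : ℕ) : Set (Fin n → Fin n → Fin n → ℝ) :=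
  {A | IsSymT n A ∧ ∀ P ∈ SOset n, ∀ Q ∈ SOset n, ∀ R ∈ SOset n,
    FObj n A P Q R ≤ FObj n A 1 1 1}

/-- The orbit of a class of tensors under orthogonal transformations. -/
def orbitSet (n : ℕ) (C : Set (Fin n → Fin n → Fin n → ℝ)) :
    Set (Fin n → Fin n → Fin n → ℝ) :=
  {B | ∃ A ∈ C, ∃ Q : Matrix (Fin n) (Fin n) ℝ, Qᵀ * Q = 1 ∧ B = transform n A Q}

lemma aux_tri {n : ℕ} (A : Fin n → Fin n → Fin n → ℝ) (Q : Matrix (Fin n) (Fin n) ℝ)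
    (x y z : Fin n → ℝ) :
    ∑ i, ∑ j, ∑ k, transform n A Q i j k * x i * y j * z k =
    ∑ p, ∑ q, ∑ r, A p q r * (∑ i, Q p i * x i) * (∑ j, Q q j * y j) * (∑ k, Q r k * z k) := by
  have h1 : ∑ i, ∑ j, ∑ k, transform n A Q i j k * x i * y j * z k =
      ∑ a : Fin n × Fin n × Fin n, ∑ b : Fin n × Fin n × Fin n,
        A b.1 b.2.1 b.2.2 * (Q b.1 a.1 * x a.1) * (Q b.2.1 a.2.1 * y a.2.1)
          * (Q b.2.2 a.2.2 * z a.2.2) := by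
    simp only [Fintype.sum_prod_type, transform, Finset.sum_mul]
    refine Finset.sum_congr rfl fun i _ => Finset.sum_congr rfl fun j _ =>
      Finset.sum_congr rfl fun k _ => Finset.sum_congr rfl fun p _ =>
      Finset.sum_congr rfl fun q _ => Finset.sum_congr rfl fun r _ => ?_
    ring
  rw [h1, Finset.sum_comm]
  simp only [Fintype.sum_prod_type]
  refine Finset.sum_congr rfl fun p _ => Finset.sum_congr rfl fun q _ =>
      Finset.sum_congr rfl fun r _ => ?_
  simp only [← Finset.mul_sum, ← Finset.sum_mul]

lemma aux_transform_mul {n : ℕ} (A : Fin n → Fin n → Fin n → ℝ)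
    (Q P : Matrix (Fin n) (Fin n) ℝ) :
    transform n (transform n A Q) P = transform n A (Q * P) := by
  funext i j k
  exact aux_tri A Q (fun a => P a i) (fun a => P a j) (fun a => P a k)

lemma aux_F_transform {n : ℕ} (A : Fin n → Fin n → Fin n → ℝ)
    (Q P₁ P₂ P₃ : Matrix (Fin n) (Fin n) ℝ) :
    FObj n (transform n A Q) P₁ P₂ P₃ = FObj n A (Q * P₁) (Q * P₂) (Q * P₃) := by
  unfold FObj
  refine Finset.sum_congr rfl fun i _ => ?_
  congr 1
  exact aux_tri A Q (fun a => P₁ a i) (fun a => P₂ a i) (fun a => P₃ a i)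

lemma aux_transform_one {n : ℕ} (A : Fin n → Fin n → Fin n → ℝ) :
    transform n A 1 = A := by
  funext i j k
  simp [transform, Matrix.one_apply]

lemma aux_sym_s9 {n : ℕ} {A : Fin n → Fin n → Fin n → ℝ} (hA : IsSymT n A)
    (Q : Matrix (Fin n) (Fin n) ℝ) : IsSymT n (transform n A Q) := by
  intro i j k
  constructor
  · unfold transform
    rw [Finset.sum_comm]
    refine Finset.sum_congr rfl fun p _ => Finset.sum_congr rfl fun q _ =>
      Finset.sum_congr rfl fun r _ => ?_
    rw [(hA q p r).1]; ring
  · unfold transform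
    refine Finset.sum_congr rfl fun p _ => ?_
    rw [Finset.sum_comm]
    refine Finset.sum_congr rfl fun q _ =>
      Finset.sum_congr rfl fun r _ => ?_
    rw [(hA p r q).2]; ring

lemma aux_flip {n : ℕ} (hn : 2 ≤ n) (P : Matrix (Fin n) (Fin n) ℝ) (hP : Pᵀ * P = 1) :
    ∃ s : Fin n → ℝ, (∀ i, s i * s i = 1) ∧ P * diagonal s ∈ SOset n := by
  have hd : P.det * P.det = 1 := by
    have := congrArg Matrix.det hP
    simpa using this
  let i0 : Fin n := ⟨0, by omega⟩
  have hs : ∀ i, (Function.update (fun _ => (1:ℝ)) i0 P.det) i *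
      (Function.update (fun _ => (1:ℝ)) i0 P.det) i = 1 := by
    intro i
    by_cases h : i = i0
    · subst h; simpa using hd
    · simp [h]
  refine ⟨Function.update (fun _ => (1:ℝ)) i0 P.det, hs, ?_, ?_⟩
  · rw [Matrix.transpose_mul, Matrix.diagonal_transpose, Matrix.mul_assoc,
      ← Matrix.mul_assoc Pᵀ, hP, Matrix.one_mul, Matrix.diagonal_mul_diagonal,
      ← Matrix.diagonal_one]
    congr 1
    funext i
    exact hs i
  · rw [Matrix.det_mul, Matrix.det_diagonal, Finset.prod_update_of_mem (Finset.mem_univ _)]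
    simpa using hd

lemma aux_F_flip {n : ℕ} (A : Fin n → Fin n → Fin n → ℝ)
    (P Q R : Matrix (Fin n) (Fin n) ℝ) (s t u : Fin n → ℝ) (hs : ∀ i, s i * s i = 1)
    (ht : ∀ i, t i * t i = 1) (hu : ∀ i, u i * u i = 1) :
    FObj n A (P * diagonal s) (Q * diagonal t) (R * diagonal u) = FObj n A P Q R := by
  unfold FObj
  refine Finset.sum_congr rfl fun i _ => ?_
  have : ∑ p, ∑ q, ∑ r, A p q r * (P * diagonal s) p i * (Q * diagonal t) q i *
      (R * diagonal u) r i =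
      (∑ p, ∑ q, ∑ r, A p q r * P p i * Q q i * R r i) * (s i * t i * u i) := by
    simp only [Finset.sum_mul, Matrix.mul_diagonal]
    refine Finset.sum_congr rfl fun p _ => Finset.sum_congr rfl fun q _ =>
      Finset.sum_congr rfl fun r _ => ?_
    ring
  rw [this, mul_pow]
  have h : (s i * t i * u i) ^ 2 = 1 := by
    calc _ = (s i * s i) * (t i * t i) * (u i * u i) := by ring
      _ = 1 := by rw [hs, ht, hu]; norm_num
  rw [h, mul_one]

lemma aux_f_eq {n : ℕ} (A : Fin n → Fin n → Fin n → ℝ) (Q : Matrix (Fin n) (Fin n) ℝ) :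
    fObj n A Q = FObj n A Q Q Q := rfl

lemma aux_compact (n : ℕ) : IsCompact {Q : Matrix (Fin n) (Fin n) ℝ | Qᵀ * Q = 1} := by
  have hc : IsCompact (Set.pi Set.univ fun _ : Fin n => Set.pi Set.univ
      fun _ : Fin n => Set.Icc (-1:ℝ) 1) :=
    isCompact_univ_pi fun _ => isCompact_univ_pi fun _ => isCompact_Icc
  refine IsCompact.of_isClosed_subset (X := Matrix (Fin n) (Fin n) ℝ) hc ?_ ?_
  · exact isClosed_eq (by fun_prop) continuous_const
  · intro Q hQ i _ j _
    have h : ∑ k, Q k j * Q k j = 1 := by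
      have := congrFun (congrFun hQ j) j
      simpa [Matrix.mul_apply] using this
    have h2 : Q i j * Q i j ≤ 1 := by
      rw [← h]
      exact Finset.single_le_sum (f := fun k => Q k j * Q k j)
        (fun k _ => mul_self_nonneg _) (Finset.mem_univ i)
    exact abs_le.1 (abs_le_one_iff_mul_self_le_one.2 h2)

lemma aux_max {n : ℕ} (A : Fin n → Fin n → Fin n → ℝ) :
    ∃ Q : Matrix (Fin n) (Fin n) ℝ, Qᵀ * Q = 1 ∧
      ∀ P : Matrix (Fin n) (Fin n) ℝ, Pᵀ * P = 1 → fObj n A P ≤ fObj n A Q := by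
  have hcont : Continuous (fun Q : Matrix (Fin n) (Fin n) ℝ => fObj n A Q) := by
    unfold fObj transform
    fun_prop
  obtain ⟨Q, hQ, hm⟩ := (aux_compact n).exists_isMaxOn ⟨1, by simp⟩ hcont.continuousOn
  exact ⟨Q, hQ, fun P hP => hm hP⟩

lemma aux_orth_mul {n : ℕ} {P Q : Matrix (Fin n) (Fin n) ℝ} (hP : Pᵀ * P = 1)
    (hQ : Qᵀ * Q = 1) : (P * Q)ᵀ * (P * Q) = 1 := by
  rw [Matrix.transpose_mul, Matrix.mul_assoc, ← Matrix.mul_assoc Pᵀ, hP, Matrix.one_mul, hQ]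

lemma aux_GMD {n : ℕ} (hn : 2 ≤ n) {A : Fin n → Fin n → Fin n → ℝ} (hA : A ∈ GMDset n)
    {P Q R : Matrix (Fin n) (Fin n) ℝ} (hP : Pᵀ * P = 1) (hQ : Qᵀ * Q = 1)
    (hR : Rᵀ * R = 1) : FObj n A P Q R ≤ FObj n A 1 1 1 := by
  obtain ⟨s, hs, hs'⟩ := aux_flip hn P hP
  obtain ⟨t, ht, ht'⟩ := aux_flip hn Q hQ
  obtain ⟨u, hu, hu'⟩ := aux_flip hn R hR
  rw [← aux_F_flip A P Q R s t u hs ht hu]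
  exact hA.2 _ hs' _ ht' _ hu'

lemma aux_MD {n : ℕ} (hn : 2 ≤ n) {A : Fin n → Fin n → Fin n → ℝ} (hA : A ∈ MDset n)
    {P : Matrix (Fin n) (Fin n) ℝ} (hP : Pᵀ * P = 1) : fObj n A P ≤ fObj n A 1 := by
  obtain ⟨s, hs, hs'⟩ := aux_flip hn P hP
  rw [aux_f_eq, ← aux_F_flip A P P P s s s hs hs hs]
  exact hA.2 _ hs'

/-- Proposition 5.1 / `lemma-equi-GMD`.
For `n ≥ 2`: `O(GMD_n) = S_n` if and only if `GMD_n = MD_n`. -/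
theorem stmt_9 (n : ℕ) (hn : 2 ≤ n) :
    orbitSet n (GMDset n) = {A | IsSymT n A} ↔ GMDset n = MDset n := by
  constructor
  · intro h
    apply Set.Subset.antisymm
    · intro A hA
      exact ⟨hA.1, fun Q hQ => hA.2 Q hQ Q hQ Q hQ⟩
    · intro A hA
      have hA' : A ∈ orbitSet n (GMDset n) := by rw [h]; exact hA.1
      obtain ⟨B, hB, Q, hQ, rfl⟩ := hA'
      refine ⟨hA.1, fun P₁ h₁ P₂ h₂ P₃ h₃ => ?_⟩
      have hQ' : Q * Qᵀ = 1 := mul_eq_one_comm.1 hQ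
      have hm := aux_MD hn hA (P := Qᵀ) (by rwa [Matrix.transpose_transpose])
      rw [aux_f_eq, aux_F_transform, hQ', aux_f_eq] at hm
      refine le_trans ?_ hm
      rw [aux_F_transform]
      exact aux_GMD hn hB (aux_orth_mul hQ h₁.1) (aux_orth_mul hQ h₂.1) (aux_orth_mul hQ h₃.1)
  · intro h
    rw [h]
    apply Set.Subset.antisymm
    · rintro _ ⟨A, hA, Q, _, rfl⟩
      exact aux_sym_s9 hA.1 Q
    · intro A hA
      obtain ⟨Q, hQ, hm⟩ := aux_max A
      have hQ' : Q * Qᵀ = 1 := mul_eq_one_comm.1 hQ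
      refine ⟨transform n A Q, ⟨aux_sym_s9 hA Q, fun P hP => ?_⟩, Qᵀ, ?_, ?_⟩
      · have := hm (Q * P) (aux_orth_mul hQ hP.1)
        rw [aux_f_eq, aux_f_eq, aux_F_transform, aux_F_transform, Matrix.mul_one]
        exact this
      · rwa [Matrix.transpose_transpose]
      · rw [aux_transform_mul, hQ', aux_transform_one]
end

section
/- In dimension 2 the maximally diagonal and generally maximally diagonal tensors coincide: MD_2 = GMD_2. Equivalently, for every A ∈ S_2, if the identity I₂ is a global maximum point of f over SO(2), then (I₂, I₂, I₂) is a global maximum point of F over SO(2)³, and conversely. -/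
open scoped BigOperators
open Matrix

lemma aux_rot (Q : Matrix (Fin 2) (Fin 2) ℝ) (hQ : Q ∈ SOset 2) :
    ∃ θ : ℝ, Q 0 0 = Real.cos θ ∧ Q 1 0 = Real.sin θ ∧ Q 0 1 = -Real.sin θ ∧
      Q 1 1 = Real.cos θ := by
  obtain ⟨h1, h2⟩ := hQ
  have e00 := congrFun (congrFun h1 0) 0
  have e01 := congrFun (congrFun h1 0) 1
  have e11 := congrFun (congrFun h1 1) 1
  simp [Matrix.mul_apply, Fin.sum_univ_two] at e00 e01 e11
  rw [Matrix.det_fin_two] at h2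
  have hu : Q 0 0 ^ 2 + Q 1 0 ^ 2 = 1 := by linarith [e00]
  have h3 : Q 1 1 = Q 0 0 := by
    linear_combination Q 0 0 * h2 - Q 1 1 * e00 + Q 1 0 * e01
  have h4 : Q 0 1 = - Q 1 0 := by
    linear_combination (-Q 1 0) * h2 - Q 0 1 * e00 + Q 0 0 * e01
  let w : ℂ := ⟨Q 0 0, Q 1 0⟩
  have hw : ‖w‖ = 1 := by
    rw [Complex.norm_def, Complex.normSq_apply]
    simp only [w]
    rw [e00, Real.sqrt_one]
  have hw0 : w ≠ 0 := by
    intro h; rw [h] at hw; simp at hw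
  refine ⟨Complex.arg w, ?_, ?_, ?_, ?_⟩
  · rw [Complex.cos_arg hw0, hw]; simp [w]
  · rw [Complex.sin_arg, hw]; simp [w]
  · rw [Complex.sin_arg, hw, h4]; simp [w]
  · rw [Complex.cos_arg hw0, hw, h3]; simp [w]

noncomputable def auxRot (θ : ℝ) : Matrix (Fin 2) (Fin 2) ℝ :=
  !![Real.cos θ, -Real.sin θ; Real.sin θ, Real.cos θ]

lemma auxRot_mem (θ : ℝ) : auxRot θ ∈ SOset 2 := by
  have h := Real.sin_sq_add_cos_sq θ
  constructor
  · ext i j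
    fin_cases i <;> fin_cases j <;>
      simp [auxRot, Matrix.mul_apply, Fin.sum_univ_two] <;> linarith
  · rw [auxRot, Matrix.det_fin_two_of]; linarith

lemma aux_eq (Q : Matrix (Fin 2) (Fin 2) ℝ) (hQ : Q ∈ SOset 2) : ∃ θ, Q = auxRot θ := by
  obtain ⟨θ, h1, h2, h3, h4⟩ := aux_rot Q hQ
  refine ⟨θ, ?_⟩
  ext i j
  fin_cases i <;> fin_cases j <;> simp [auxRot, h1, h2, h3, h4]

lemma aux_F (A : Fin 2 → Fin 2 → Fin 2 → ℝ) (hA : IsSymT 2 A) (α β γ : ℝ) :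
    FObj 2 A (auxRot α) (auxRot β) (auxRot γ) =
      ((A 0 0 0 - 3 * A 0 1 1) / 4
        + (A 0 0 0 + A 0 1 1) / 4 * (Real.cos (2 * (α + β)) + Real.cos (2 * (α + γ))
            + Real.cos (2 * (β + γ)))
        + (A 0 0 1 + A 1 1 1) / 4 * (Real.sin (2 * (α + β)) + Real.sin (2 * (α + γ))
            + Real.sin (2 * (β + γ)))) ^ 2 +
      (-(3 * A 0 0 1 - A 1 1 1) / 4
        + (A 0 0 1 + A 1 1 1) / 4 * (Real.cos (2 * (α + β)) + Real.cos (2 * (α + γ))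
            + Real.cos (2 * (β + γ)))
        - (A 0 0 0 + A 0 1 1) / 4 * (Real.sin (2 * (α + β)) + Real.sin (2 * (α + γ))
            + Real.sin (2 * (β + γ)))) ^ 2 := by
  have s1 : A 0 1 0 = A 0 0 1 := (hA 0 1 0).2
  have s2 : A 1 0 0 = A 0 0 1 := by rw [(hA 1 0 0).1, s1]
  have s3 : A 1 0 1 = A 0 1 1 := (hA 1 0 1).1
  have s4 : A 1 1 0 = A 0 1 1 := by rw [(hA 1 1 0).2, s3]
  simp only [FObj, Fin.sum_univ_two, auxRot, Matrix.of_apply, Matrix.cons_val', Matrix.cons_val_zero,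
    Matrix.cons_val_one, Matrix.cons_val_fin_one, s1, s2, s3, s4]
  generalize A 0 0 0 = a
  generalize A 0 0 1 = b
  generalize A 0 1 1 = c
  generalize A 1 1 1 = d
  have k1 : ∀ x y z : ℝ, Real.cos (x + y - z) =
      Real.cos (x + y + z) * Real.cos (2 * (x + y)) + Real.sin (x + y + z) * Real.sin (2 * (x + y)) := by
    intro x y z
    rw [← Real.cos_sub, ← Real.cos_neg]; congr 1; ring
  have k2 : ∀ x y z : ℝ, Real.sin (x + y - z) =
      Real.cos (x + y + z) * Real.sin (2 * (x + y)) - Real.sin (x + y + z) * Real.cos (2 * (x + y)) := by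
    intro x y z
    have := Real.sin_sub (2 * (x + y)) (x + y + z)
    rw [show 2 * (x + y) - (x + y + z) = x + y - z by ring] at this
    rw [this]; ring
  have c1 := k1 α β γ
  have c2 := k1 α γ β
  have c3 := k1 β γ α
  have d1 := k2 α β γ
  have d2 := k2 α γ β
  have d3 := k2 β γ α
  rw [show α + γ + β = α + β + γ by ring] at c2 d2
  rw [show β + γ + α = α + β + γ by ring] at c3 d3
  have hS := Real.sin_sq_add_cos_sq (α + β + γ)
  set C := Real.cos (2 * (α + β)) + Real.cos (2 * (α + γ)) + Real.cos (2 * (β + γ)) with hC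
  set D := Real.sin (2 * (α + β)) + Real.sin (2 * (α + γ)) + Real.sin (2 * (β + γ)) with hD
  have c4 : Real.cos (α + β - γ) + Real.cos (α + γ - β) + Real.cos (β + γ - α) =
      Real.cos (α + β + γ) * C + Real.sin (α + β + γ) * D := by
    rw [c1, c2, c3, hC, hD]; ring
  have d4 : Real.sin (α + β - γ) + Real.sin (α + γ - β) + Real.sin (β + γ - α) =
      Real.cos (α + β + γ) * D - Real.sin (α + β + γ) * C := by
    rw [d1, d2, d3, hC, hD]; ring
  set U := (a - 3 * c) / 4 + (a + c) / 4 * C + (b + d) / 4 * D with hU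
  set V := -(3 * b - d) / 4 + (b + d) / 4 * C - (a + c) / 4 * D with hV
  have hX : Real.cos (α + β + γ) * U - Real.sin (α + β + γ) * V =
      (a - 3 * c) / 4 * Real.cos (α + β + γ) + (3 * b - d) / 4 * Real.sin (α + β + γ)
      + (a + c) / 4 * (Real.cos (α + β - γ) + Real.cos (α + γ - β) + Real.cos (β + γ - α))
      + (b + d) / 4 * (Real.sin (α + β - γ) + Real.sin (α + γ - β) + Real.sin (β + γ - α)) := by
    rw [c4, d4, hU, hV]; ring
  have hY : Real.sin (α + β + γ) * U + Real.cos (α + β + γ) * V =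
      (a - 3 * c) / 4 * Real.sin (α + β + γ) - (3 * b - d) / 4 * Real.cos (α + β + γ)
      + (b + d) / 4 * (Real.cos (α + β - γ) + Real.cos (α + γ - β) + Real.cos (β + γ - α))
      - (a + c) / 4 * (Real.sin (α + β - γ) + Real.sin (α + γ - β) + Real.sin (β + γ - α)) := by
    rw [c4, d4, hU, hV]; ring
  have hUV : U ^ 2 + V ^ 2 = (Real.cos (α + β + γ) * U - Real.sin (α + β + γ) * V) ^ 2 +
      (Real.sin (α + β + γ) * U + Real.cos (α + β + γ) * V) ^ 2 := by
    linear_combination (-(U ^ 2 + V ^ 2)) * hS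
  rw [hUV, hX, hY]
  simp only [Real.cos_sub, Real.sin_sub, Real.cos_add, Real.sin_add]
  congr 1 <;> · congr 1; ring

lemma aux_one : (1 : Matrix (Fin 2) (Fin 2) ℝ) ∈ SOset 2 := by
  simp [SOset]

lemma aux_main (A : Fin 2 → Fin 2 → Fin 2 → ℝ) (hA : IsSymT 2 A) :
    (∀ Q ∈ SOset 2, fObj 2 A Q ≤ fObj 2 A 1) ↔
      (∀ P ∈ SOset 2, ∀ Q ∈ SOset 2, ∀ R ∈ SOset 2,
        FObj 2 A P Q R ≤ FObj 2 A 1 1 1) := by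
  have hf : ∀ Q, fObj 2 A Q = FObj 2 A Q Q Q := fun Q => rfl
  constructor
  · intro h P hP Q hQ R hR
    obtain ⟨α, rfl⟩ := aux_eq P hP
    obtain ⟨β, rfl⟩ := aux_eq Q hQ
    obtain ⟨γ, rfl⟩ := aux_eq R hR
    have h1 := h _ (auxRot_mem ((α + β) / 2))
    have h2 := h _ (auxRot_mem ((α + γ) / 2))
    have h3 := h _ (auxRot_mem ((β + γ) / 2))
    rw [hf, hf 1, aux_F A hA, add_halves] at h1 h2 h3
    rw [aux_F A hA]
    have key : ∀ z x y w : ℝ, (z + (x + y + w)) ^ 2 ≤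
        ((z + 3 * x) ^ 2 + (z + 3 * y) ^ 2 + (z + 3 * w) ^ 2) / 3 := by
      intro z x y w
      nlinarith [sq_nonneg (x - y), sq_nonneg (x - w), sq_nonneg (y - w)]
    generalize A 0 0 0 = a at *
    generalize A 0 0 1 = b at *
    generalize A 0 1 1 = c at *
    generalize A 1 1 1 = d at *
    generalize Real.cos (2 * (α + β)) = p1 at *
    generalize Real.cos (2 * (α + γ)) = p2 at *
    generalize Real.cos (2 * (β + γ)) = p3 at *
    generalize Real.sin (2 * (α + β)) = q1 at *
    generalize Real.sin (2 * (α + γ)) = q2 at *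
    generalize Real.sin (2 * (β + γ)) = q3 at *
    have k1 := key ((a - 3 * c) / 4) ((a + c) / 4 * p1 + (b + d) / 4 * q1)
      ((a + c) / 4 * p2 + (b + d) / 4 * q2) ((a + c) / 4 * p3 + (b + d) / 4 * q3)
    have k2 := key (-(3 * b - d) / 4) ((b + d) / 4 * p1 - (a + c) / 4 * q1)
      ((b + d) / 4 * p2 - (a + c) / 4 * q2) ((b + d) / 4 * p3 - (a + c) / 4 * q3)
    linarith
  · intro h Q hQ
    rw [hf, hf]
    exact h Q hQ Q hQ Q hQ

/-- Theorem 5.3 / `equal-dim-2`.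
In dimension 2 the maximally diagonal and generally maximally diagonal tensors coincide:
`MD_2 = GMD_2`. Equivalently, for every `A ∈ S_2`, the identity `I₂` is a global maximum
point of `f` over `SO(2)` iff `(I₂, I₂, I₂)` is a global maximum point of `F` over
`SO(2)³`. -/
theorem stmt_11 :
    MDset 2 = GMDset 2 ∧
      ∀ A : Fin 2 → Fin 2 → Fin 2 → ℝ, IsSymT 2 A →
        ((∀ Q ∈ SOset 2, fObj 2 A Q ≤ fObj 2 A 1) ↔
          (∀ P ∈ SOset 2, ∀ Q ∈ SOset 2, ∀ R ∈ SOset 2,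
            FObj 2 A P Q R ≤ FObj 2 A 1 1 1)) := by
  refine ⟨?_, aux_main⟩
  ext A
  constructor
  · rintro ⟨h1, h2⟩
    exact ⟨h1, (aux_main A h1).1 h2⟩
  · rintro ⟨h1, h2⟩
    exact ⟨h1, (aux_main A h1).2 h2⟩
end

section
/- For every orthogonal matrix Q ∈ O(3), the quantity ρ(Q) = Q₁₁² Q₁₂² Q₁₃² + Q₂₁² Q₂₂² Q₂₃² + Q₃₁² Q₃₂² Q₃₃² satisfies ρ(Q) < 1/12. -/
open Matrix

/-- AM-GM for three nonnegative reals summing to 2, in a weak form. -/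
lemma amgm_aux (u v w : ℝ) (hu : 0 ≤ u) (hv : 0 ≤ v) (hw : 0 ≤ w) (h : u + v + w = 2) :
    u * v * w ≤ 8 / 27 := by
  have h1 : 27 * (u * v * w) ≤ (u + v + w) ^ 3 := by
    nlinarith [mul_nonneg hu (sq_nonneg (v - w)), mul_nonneg hv (sq_nonneg (u - w)),
      mul_nonneg hw (sq_nonneg (u - v)), mul_nonneg hu (sq_nonneg (u - v)),
      mul_nonneg hu (sq_nonneg (u - w)), mul_nonneg hv (sq_nonneg (v - u)),
      mul_nonneg hv (sq_nonneg (v - w)), mul_nonneg hw (sq_nonneg (w - u)),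
      mul_nonneg hw (sq_nonneg (w - v))]
  rw [h] at h1
  linarith

lemma main_aux (a b c d e f g h k : ℝ)
    (h01 : a * b + d * e + g * h = 0) (h02 : a * c + d * f + g * k = 0)
    (h12 : b * c + e * f + h * k = 0)
    (h00 : a * a + d * d + g * g = 1) (h11 : b * b + e * e + h * h = 1)
    (h22 : c * c + f * f + k * k = 1) (hr : g * g + h * h + k * k = 1) :
    a ^ 2 * b ^ 2 * c ^ 2 + d ^ 2 * e ^ 2 * f ^ 2 + g ^ 2 * h ^ 2 * k ^ 2 < 1 / 12 := by
  have hW : g ^ 2 * h ^ 2 * k ^ 2 = -((a * b + d * e) * (a * c + d * f) * (b * c + e * f)) := by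
    have e1 : a * b + d * e = -(g * h) := by linarith
    have e2 : a * c + d * f = -(g * k) := by linarith
    have e3 : b * c + e * f = -(h * k) := by linarith
    rw [e1, e2, e3]; ring
  have hp := amgm_aux (a ^ 2 + d ^ 2) (b ^ 2 + e ^ 2) (c ^ 2 + f ^ 2)
    (by positivity) (by positivity) (by positivity) (by linarith)
  have key : a ^ 2 * b ^ 2 * c ^ 2 + d ^ 2 * e ^ 2 * f ^ 2 + g ^ 2 * h ^ 2 * k ^ 2 =
      ((a ^ 2 + d ^ 2) * (b ^ 2 + e ^ 2) * (c ^ 2 + f ^ 2)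
        - (a * b * c + (a * e * f + d * b * f + d * e * c)) ^ 2
        - (d * e * f + (a * b * f + a * e * c + d * b * c)) ^ 2) / 4 := by
    rw [hW]; ring
  rw [key]
  nlinarith [sq_nonneg (a * b * c + (a * e * f + d * b * f + d * e * c)),
    sq_nonneg (d * e * f + (a * b * f + a * e * c + d * b * c))]

/-- Lemma 5.5 / `lemma-before-counter`.
For every orthogonal `Q ∈ O(3)`,
`ρ(Q) = Q₁₁²Q₁₂²Q₁₃² + Q₂₁²Q₂₂²Q₂₃² + Q₃₁²Q₃₂²Q₃₃² < 1/12`. -/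
theorem stmt_12 (Q : Matrix (Fin 3) (Fin 3) ℝ) (hQ : Qᵀ * Q = 1) :
    Q 0 0 ^ 2 * Q 0 1 ^ 2 * Q 0 2 ^ 2 +
      Q 1 0 ^ 2 * Q 1 1 ^ 2 * Q 1 2 ^ 2 +
      Q 2 0 ^ 2 * Q 2 1 ^ 2 * Q 2 2 ^ 2 < 1 / 12 := by
  have hQ' : Q * Qᵀ = 1 := mul_eq_one_comm.mp hQ
  have H := fun i j => congrFun (congrFun hQ i) j
  have hr := congrFun (congrFun hQ' 2) 2
  simp only [Matrix.mul_apply, Matrix.transpose_apply, Fin.sum_univ_three] at H hr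
  exact main_aux _ _ _ _ _ _ _ _ _ (by simpa using H 0 1) (by simpa using H 0 2)
    (by simpa using H 1 2) (by simpa using H 0 0) (by simpa using H 1 1)
    (by simpa using H 2 2) (by simpa using hr)
end

section
/- Let A ∈ S_3 be the symmetric tensor with A_{ijk} = 1 whenever {i,j,k} = {1,2,3} (i.e. i, j, k is a permutation of 1, 2, 3) and A_{ijk} = 0 otherwise. Then for every Q ∈ O(3) one has f(Q) < 3, while taking P_* = I₃, Q_* the permutation matrix sending e₁ ↦ e₂, e₂ ↦ e₃, e₃ ↦ e₁ columns as [e₂ e₃ e₁]-type cyclic permutation with Q_* having columns (e₂, e₃, e₁) and R_* having columns (e₃, e₁, e₂) (both of determinant 1), one has F(P_*, Q_*, R_*) = 3. Consequently max_{Q ∈ SO(3)} f(Q) < max_{P,Q,R ∈ SO(3)} F(P,Q,R) for this tensor A. -/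
open scoped BigOperators
open Matrix

/-- The tensor of Example 3.26 / 5.6: `A_{ijk} = 1` whenever `i, j, k` is a permutation
of `1, 2, 3`, and `0` otherwise. -/
noncomputable def exTensor3 : Fin 3 → Fin 3 → Fin 3 → ℝ :=
  fun i j k => if i ≠ j ∧ j ≠ k ∧ i ≠ k then 1 else 0

/-- The symmetric trilinear form of the tensor. -/
def T3 (a b c : Fin 3 → ℝ) : ℝ :=
  a 0 * (b 1 * c 2 + b 2 * c 1) + a 1 * (b 0 * c 2 + b 2 * c 0) + a 2 * (b 0 * c 1 + b 1 * c 0)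

lemma T3_comm12 (a b c : Fin 3 → ℝ) : T3 a b c = T3 b a c := by unfold T3; ring

lemma T3_comm23 (a b c : Fin 3 → ℝ) : T3 a b c = T3 a c b := by unfold T3; ring

lemma exT_sum (a b c : Fin 3 → ℝ) :
    ∑ p, ∑ q, ∑ r, exTensor3 p q r * a p * b q * c r = T3 a b c := by
  simp [Fin.sum_univ_three, exTensor3, T3]
  ring

lemma parseval3 (x y z : Fin 3 → ℝ)
    (h : ∀ p q, x p * x q + y p * y q + z p * z q = if p = q then 1 else 0)
    (u v w : ℝ) :
    (u * x 0 + v * x 1 + w * x 2) ^ 2 + (u * y 0 + v * y 1 + w * y 2) ^ 2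
      + (u * z 0 + v * z 1 + w * z 2) ^ 2 = u ^ 2 + v ^ 2 + w ^ 2 := by
  have h00 := h 0 0
  have h11 := h 1 1
  have h22 := h 2 2
  have h01 := h 0 1
  have h02 := h 0 2
  have h12 := h 1 2
  simp at h00 h11 h22 h01 h02 h12
  linear_combination u ^ 2 * h00 + v ^ 2 * h11 + w ^ 2 * h22 + 2 * u * v * h01
    + 2 * u * w * h02 + 2 * v * w * h12

lemma T3_norm2 (x y z : Fin 3 → ℝ)
    (h : ∀ p q, x p * x q + y p * y q + z p * z q = if p = q then 1 else 0)
    (a b : Fin 3 → ℝ) :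
    T3 a b x ^ 2 + T3 a b y ^ 2 + T3 a b z ^ 2 =
      (a 1 * b 2 + a 2 * b 1) ^ 2 + (a 0 * b 2 + a 2 * b 0) ^ 2
        + (a 0 * b 1 + a 1 * b 0) ^ 2 := by
  have := parseval3 x y z h (a 1 * b 2 + a 2 * b 1) (a 0 * b 2 + a 2 * b 0)
    (a 0 * b 1 + a 1 * b 0)
  rw [← this]
  unfold T3
  ring

lemma T3_norm1 (x y z : Fin 3 → ℝ)
    (h : ∀ p q, x p * x q + y p * y q + z p * z q = if p = q then 1 else 0)
    (a : Fin 3 → ℝ) :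
    (T3 a x x ^ 2 + T3 a x y ^ 2 + T3 a x z ^ 2) + (T3 a y x ^ 2 + T3 a y y ^ 2 + T3 a y z ^ 2)
      + (T3 a z x ^ 2 + T3 a z y ^ 2 + T3 a z z ^ 2) =
      2 * (a 0 ^ 2 + a 1 ^ 2 + a 2 ^ 2) := by
  rw [T3_norm2 x y z h, T3_norm2 x y z h, T3_norm2 x y z h]
  have h1 := parseval3 x y z h 0 (a 2) (a 1)
  have h2 := parseval3 x y z h (a 2) 0 (a 0)
  have h3 := parseval3 x y z h (a 1) (a 0) 0
  linear_combination h1 + h2 + h3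

lemma T3_trace (x y z : Fin 3 → ℝ)
    (h : ∀ p q, x p * x q + y p * y q + z p * z q = if p = q then 1 else 0)
    (a : Fin 3 → ℝ) : T3 a x x + T3 a y y + T3 a z z = 0 := by
  have h01 := h 0 1
  have h02 := h 0 2
  have h12 := h 1 2
  simp at h01 h02 h12
  unfold T3
  linear_combination 2 * a 0 * h12 + 2 * a 1 * h02 + 2 * a 2 * h01

lemma T3_bound (x y z : Fin 3 → ℝ)
    (h : ∀ p q, x p * x q + y p * y q + z p * z q = if p = q then 1 else 0) :
    T3 x x x ^ 2 + T3 y y y ^ 2 + T3 z z z ^ 2 ≤ 12 / 5 := by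
  have nx := T3_norm1 x y z h x
  have ny := T3_norm1 x y z h y
  have nz := T3_norm1 x y z h z
  have tx := T3_trace x y z h x
  have ty := T3_trace x y z h y
  have tz := T3_trace x y z h z
  have h00 := h 0 0
  have h11 := h 1 1
  have h22 := h 2 2
  simp at h00 h11 h22
  have e1 : T3 x y x = T3 x x y := T3_comm23 _ _ _
  have e2 : T3 y x x = T3 x x y := by rw [T3_comm12, e1]
  have e3 : T3 x z x = T3 x x z := T3_comm23 _ _ _
  have e4 : T3 z x x = T3 x x z := by rw [T3_comm12, e3]
  have e5 : T3 y x y = T3 x y y := T3_comm12 _ _ _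
  have e6 : T3 y y x = T3 x y y := by rw [T3_comm23, e5]
  have e7 : T3 z x z = T3 x z z := T3_comm12 _ _ _
  have e8 : T3 z z x = T3 x z z := by rw [T3_comm23, e7]
  have e9 : T3 y z y = T3 y y z := T3_comm23 _ _ _
  have e10 : T3 z y y = T3 y y z := by rw [T3_comm12, e9]
  have e11 : T3 z y z = T3 y z z := T3_comm12 _ _ _
  have e12 : T3 z z y = T3 y z z := by rw [T3_comm23, e11]
  rw [e1, e3] at nx
  rw [e2, e5, e6, e9] at ny
  rw [e4, e7, e8, e10, e11, e12] at nz
  rw [e2] at ty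
  rw [e4, e10] at tz
  have ax : T3 x x x ^ 2 = (T3 x y y + T3 x z z) ^ 2 := by
    rw [show T3 x x x = -(T3 x y y + T3 x z z) by linarith]; ring
  have ay : T3 y y y ^ 2 = (T3 x x y + T3 y z z) ^ 2 := by
    rw [show T3 y y y = -(T3 x x y + T3 y z z) by linarith]; ring
  have az : T3 z z z ^ 2 = (T3 x x z + T3 y y z) ^ 2 := by
    rw [show T3 z z z = -(T3 x x z + T3 y y z) by linarith]; ring
  have exz : T3 y x z = T3 x y z := T3_comm12 _ _ _
  linarith [sq_nonneg (T3 x y y - T3 x z z), sq_nonneg (T3 x x y - T3 y z z),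
    sq_nonneg (T3 x x z - T3 y y z), sq_nonneg (T3 x y z), sq_nonneg (T3 x z y),
    sq_nonneg (T3 y x z), sq_nonneg (T3 y z x), sq_nonneg (T3 z x y), sq_nonneg (T3 z y x)]

lemma fObj_bound (Q : Matrix (Fin 3) (Fin 3) ℝ) (hQ : Qᵀ * Q = 1) :
    fObj 3 exTensor3 Q ≤ 12 / 5 := by
  have hQ' : Q * Qᵀ = 1 := mul_eq_one_comm.mp hQ
  have h := T3_bound (fun p => Q p 0) (fun p => Q p 1) (fun p => Q p 2) (by
    intro p q
    have := congrFun (congrFun hQ' p) q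
    simpa [Matrix.mul_apply, Fin.sum_univ_three, Matrix.one_apply] using this)
  have e : ∀ i, transform 3 exTensor3 Q i i i
      = T3 (fun p => Q p i) (fun p => Q p i) (fun p => Q p i) := fun i =>
    exT_sum (fun p => Q p i) (fun p => Q p i) (fun p => Q p i)
  unfold fObj
  rw [Fin.sum_univ_three, e, e, e]
  exact h

lemma entry_le (Q : Matrix (Fin 3) (Fin 3) ℝ) (hQ : Q ∈ SOset 3) (i j : Fin 3) :
    |Q i j| ≤ 1 := by
  have := congrFun (congrFun hQ.1 j) j
  simp only [Matrix.mul_apply, Matrix.transpose_apply, Matrix.one_apply, if_true] at this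
  have h2 : Q i j * Q i j ≤ ∑ k, Q k j * Q k j :=
    Finset.single_le_sum (f := fun k => Q k j * Q k j) (fun k _ => mul_self_nonneg _)
      (Finset.mem_univ i)
  rw [← sq_le_one_iff_abs_le_one]
  nlinarith

lemma FObj_bound (P Q R : Matrix (Fin 3) (Fin 3) ℝ) (hP : P ∈ SOset 3) (hQ : Q ∈ SOset 3)
    (hR : R ∈ SOset 3) : FObj 3 exTensor3 P Q R ≤ 3 * 27 ^ 2 := by
  have key : ∀ i, |∑ p, ∑ q, ∑ r, exTensor3 p q r * P p i * Q q i * R r i| ≤ 27 := by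
    intro i
    have ht : ∀ p q r, |exTensor3 p q r * P p i * Q q i * R r i| ≤ 1 := by
      intro p q r
      rw [abs_mul, abs_mul, abs_mul]
      have hA : |exTensor3 p q r| ≤ 1 := by
        unfold exTensor3; split_ifs <;> simp
      exact mul_le_one₀ (mul_le_one₀ (mul_le_one₀ hA (abs_nonneg _) (entry_le P hP p i))
        (abs_nonneg _) (entry_le Q hQ q i)) (abs_nonneg _) (entry_le R hR r i)
    calc _ ≤ ∑ p : Fin 3, ∑ q : Fin 3, ∑ r : Fin 3, (1 : ℝ) := by
          refine (Finset.abs_sum_le_sum_abs _ _).trans (Finset.sum_le_sum fun p _ => ?_)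
          refine (Finset.abs_sum_le_sum_abs _ _).trans (Finset.sum_le_sum fun q _ => ?_)
          exact (Finset.abs_sum_le_sum_abs _ _).trans (Finset.sum_le_sum fun r _ => ht p q r)
      _ = 27 := by norm_num
  unfold FObj
  calc _ ≤ ∑ i : Fin 3, (27 : ℝ) ^ 2 :=
        Finset.sum_le_sum fun i _ => sq_le_sq' (abs_le.mp (key i)).1 (abs_le.mp (key i)).2
    _ = _ := by norm_num

/-- Example 5.6 / `exam-counter`.
For the tensor above: `f(Q) < 3` for every `Q ∈ O(3)`, while with `P_* = I₃`,
`Q_*` the matrix with columns `(e₂, e₃, e₁)` and `R_*` the matrix with columns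
`(e₃, e₁, e₂)` (both in `SO(3)`) one has `F(P_*, Q_*, R_*) = 3`. Consequently
`max_{Q ∈ SO(3)} f(Q) < max_{P,Q,R ∈ SO(3)} F(P,Q,R)`. -/
theorem stmt_13 :
    (∀ Q : Matrix (Fin 3) (Fin 3) ℝ, Qᵀ * Q = 1 → fObj 3 exTensor3 Q < 3) ∧
    FObj 3 exTensor3 (1 : Matrix (Fin 3) (Fin 3) ℝ)
      !![0,0,1; 1,0,0; 0,1,0] !![0,1,0; 0,0,1; 1,0,0] = 3 ∧
    (1 : Matrix (Fin 3) (Fin 3) ℝ) ∈ SOset 3 ∧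
    (!![0,0,1; 1,0,0; 0,1,0] : Matrix (Fin 3) (Fin 3) ℝ) ∈ SOset 3 ∧
    (!![0,1,0; 0,0,1; 1,0,0] : Matrix (Fin 3) (Fin 3) ℝ) ∈ SOset 3 ∧
    sSup {y : ℝ | ∃ Q ∈ SOset 3, y = fObj 3 exTensor3 Q} <
      sSup {y : ℝ | ∃ P ∈ SOset 3, ∃ Q ∈ SOset 3, ∃ R ∈ SOset 3,
        y = FObj 3 exTensor3 P Q R} := by
  have hone : (1 : Matrix (Fin 3) (Fin 3) ℝ) ∈ SOset 3 := by simp [SOset]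
  have hq : (!![0,0,1; 1,0,0; 0,1,0] : Matrix (Fin 3) (Fin 3) ℝ) ∈ SOset 3 := by
    refine ⟨?_, by simp [Matrix.det_fin_three]⟩
    ext i j
    fin_cases i <;> fin_cases j <;> simp [Matrix.mul_apply, Fin.sum_univ_three]
  have hr : (!![0,1,0; 0,0,1; 1,0,0] : Matrix (Fin 3) (Fin 3) ℝ) ∈ SOset 3 := by
    refine ⟨?_, by simp [Matrix.det_fin_three]⟩
    ext i j
    fin_cases i <;> fin_cases j <;> simp [Matrix.mul_apply, Fin.sum_univ_three]
  have hF : FObj 3 exTensor3 (1 : Matrix (Fin 3) (Fin 3) ℝ)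
      !![0,0,1; 1,0,0; 0,1,0] !![0,1,0; 0,0,1; 1,0,0] = 3 := by
    simp [FObj, Fin.sum_univ_three, exTensor3]
    norm_num
  refine ⟨fun Q hQ => lt_of_le_of_lt (fObj_bound Q hQ) (by norm_num), hF, hone, hq, hr, ?_⟩
  have h1 : sSup {y : ℝ | ∃ Q ∈ SOset 3, y = fObj 3 exTensor3 Q} ≤ 12 / 5 := by
    refine csSup_le ⟨_, 1, hone, rfl⟩ ?_
    rintro y ⟨Q, hQ, rfl⟩
    exact fObj_bound Q hQ.1
  have h2 : (3 : ℝ) ≤ sSup {y : ℝ | ∃ P ∈ SOset 3, ∃ Q ∈ SOset 3, ∃ R ∈ SOset 3,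
        y = FObj 3 exTensor3 P Q R} := by
    refine le_csSup ⟨3 * 27 ^ 2, ?_⟩ ⟨_, hone, _, hq, _, hr, hF.symm⟩
    rintro y ⟨P, hP, Q, hQ, R, hR, rfl⟩
    exact FObj_bound P Q R hP hQ hR
  linarith
end

section
/- Let A ∈ S_n and suppose A = Σ_{k=1}^p λ_k x_k ⊗ y_k ⊗ z_k, where p ≤ n, λ_k ∈ ℝ, and x_1, …, x_p are pairwise orthogonal vectors in ℝⁿ, y_1, …, y_p are pairwise orthogonal, and z_1, …, z_p are pairwise orthogonal. Then there exist μ_k ∈ ℝ and pairwise orthogonal vectors u_1, …, u_p in ℝⁿ such that A = Σ_{k=1}^p μ_k u_k ⊗ u_k ⊗ u_k. -/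
open scoped BigOperators

theorem aux_par (n p : ℕ)
    (A : Fin n → Fin n → Fin n → ℝ) (hA : IsSymT n A)
    (lam : Fin p → ℝ) (x y z : Fin p → Fin n → ℝ)
    (hz : ∀ a b : Fin p, a ≠ b → (∑ i, z a i * z b i) = 0)
    (hdec : ∀ i j k : Fin n, A i j k = ∑ a, lam a * x a i * y a j * z a k)
    (b : Fin p) (hl : lam b ≠ 0) (k0 : Fin n) (hk : z b k0 ≠ 0) (i j : Fin n) :
    x b i * y b j = x b j * y b i := by
  have key : ∀ i j, ∑ k, A i j k * z b k = lam b * x b i * y b j * ∑ k, z b k * z b k := by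
    intro i j
    simp_rw [hdec, Finset.sum_mul]
    rw [Finset.sum_comm, Finset.sum_eq_single b]
    · rw [Finset.mul_sum]
      exact Finset.sum_congr rfl fun k _ => by ring
    · intro a _ hab
      have := hz a b hab
      calc _ = lam a * x a i * y a j * ∑ k, z a k * z b k := by
            rw [Finset.mul_sum]
            exact Finset.sum_congr rfl fun k _ => by ring
        _ = 0 := by rw [this, mul_zero]
    · simp
  have hpos : 0 < ∑ k, z b k * z b k :=
    Finset.sum_pos' (fun k _ => mul_self_nonneg _)
      ⟨k0, Finset.mem_univ _, mul_self_pos.mpr hk⟩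
  have h1 : ∑ k, A i j k * z b k = ∑ k, A j i k * z b k :=
    Finset.sum_congr rfl fun k _ => by rw [(hA i j k).1]
  rw [key, key] at h1
  have h2 := mul_right_cancel₀ hpos.ne' h1
  rw [mul_assoc, mul_assoc] at h2
  exact mul_left_cancel₀ hl h2

/-- Proposition 5.8 / `pro-analogue-Comon`.
If a symmetric tensor `A ∈ S_n` decomposes as `A = ∑_{k=1}^p λ_k x_k ⊗ y_k ⊗ z_k` with
`p ≤ n` and each of the families `x`, `y`, `z` pairwise orthogonal, then
`A = ∑_{k=1}^p μ_k u_k ⊗ u_k ⊗ u_k` for some `μ_k ∈ ℝ` and pairwise orthogonal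
vectors `u_1, …, u_p`. -/
theorem stmt_14 (n p : ℕ) (hp : p ≤ n)
    (A : Fin n → Fin n → Fin n → ℝ) (hA : IsSymT n A)
    (lam : Fin p → ℝ) (x y z : Fin p → Fin n → ℝ)
    (hx : ∀ a b : Fin p, a ≠ b → (∑ i, x a i * x b i) = 0)
    (hy : ∀ a b : Fin p, a ≠ b → (∑ i, y a i * y b i) = 0)
    (hz : ∀ a b : Fin p, a ≠ b → (∑ i, z a i * z b i) = 0)
    (hdec : ∀ i j k : Fin n, A i j k = ∑ a, lam a * x a i * y a j * z a k) :
    ∃ μ : Fin p → ℝ, ∃ u : Fin p → Fin n → ℝ,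
      (∀ a b : Fin p, a ≠ b → (∑ i, u a i * u b i) = 0) ∧
      (∀ i j k : Fin n, A i j k = ∑ a, μ a * u a i * u a j * u a k) := by
  have hdec' : ∀ i j k : Fin n, A i j k = ∑ a, lam a * x a i * z a j * y a k := by
    intro i j k
    rw [(hA i j k).2, hdec]
    exact Finset.sum_congr rfl fun a _ => by ring
  have main : ∀ a, ∃ m : ℝ, ∀ i j k,
      lam a * x a i * y a j * z a k = m * x a i * x a j * x a k := by
    intro a
    by_cases hl : lam a = 0
    · exact ⟨0, by simp [hl]⟩
    by_cases h1 : ∀ i, x a i = 0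
    · exact ⟨0, by simp [h1]⟩
    by_cases h2 : ∀ i, y a i = 0
    · exact ⟨0, by simp [h2]⟩
    by_cases h3 : ∀ i, z a i = 0
    · exact ⟨0, by simp [h3]⟩
    push Not at h1 h2 h3
    obtain ⟨i0, h1⟩ := h1
    obtain ⟨j0, h2⟩ := h2
    obtain ⟨k0, h3⟩ := h3
    have e1 := aux_par n p A hA lam x y z hz hdec a hl k0 h3 i0
    have e2 := aux_par n p A hA lam x z y hy hdec' a hl j0 h2 i0
    refine ⟨lam a * (y a i0 / x a i0) * (z a i0 / x a i0), fun i j k => ?_⟩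
    have f1 : y a j = x a j * y a i0 / x a i0 := by
      rw [eq_div_iff h1, ← e1 j]; ring
    have f2 : z a k = x a k * z a i0 / x a i0 := by
      rw [eq_div_iff h1, ← e2 k]; ring
    rw [f1, f2]; ring
  choose m hm using main
  refine ⟨m, x, hx, fun i j k => ?_⟩
  rw [hdec]
  exact Finset.sum_congr rfl fun a _ => hm a i j k
end

section
/- Let A ∈ S_n and let {Q_k : k ∈ ℕ} be the iterates of the cyclic Jacobi (Jacobi CoM) algorithm applied to A. If Q_k → Q_* as k → ∞, then the tensor W^* (the orthogonal transform of A by Q_*) satisfies d_{i,j}(W^*) = 0 and ω_{i,j}(W^*) ≥ 0 for all 1 ≤ i < j ≤ n. -/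
open scoped BigOperators
open Matrix

/-- All pairs `(i, j)` with `i < j` listed in the cyclic-by-row order
`(1,2), (1,3), …, (1,n), (2,3), …, (n-1,n)`. -/
def pairList (n : ℕ) : List (Fin n × Fin n) :=
  (List.finRange n).flatMap fun i =>
    (List.finRange n).filterMap fun j => if i < j then some (i, j) else none

/-- The sequence of pairs chosen by the cyclic-by-row rule: the pair used at step `k`
is the `(k mod N)`-th pair in the row order, where `N = n(n-1)/2`. -/
def CyclicPairs (n : ℕ) (pr : ℕ → Fin n × Fin n) : Prop :=
  ∀ k : ℕ, (pairList n)[k % (pairList n).length]? = some (pr k)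

/-- `Q : ℕ → SO(n)` is the sequence of iterates of the cyclic Jacobi (Jacobi CoM)
algorithm applied to `A` with pair sequence `pr`: `Q 0 = I`, and
`Q (k+1) = Q k * G^{(i,j,θ)}` where `(i,j) = pr k` and `θ ∈ (−π/4, π/4]` is a global
maximum point of `θ ↦ f(Q k * G^{(i,j,θ)})`. -/
def JacobiIterates (n : ℕ) (A : Fin n → Fin n → Fin n → ℝ)
    (pr : ℕ → Fin n × Fin n) (Q : ℕ → Matrix (Fin n) (Fin n) ℝ) : Prop :=
  Q 0 = 1 ∧
  ∀ k : ℕ, ∃ θ : ℝ, θ ∈ Set.Ioc (-(Real.pi / 4)) (Real.pi / 4) ∧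
    (∀ θ' : ℝ, fObj n A (Q k * givens n (pr k).1 (pr k).2 θ') ≤
        fObj n A (Q k * givens n (pr k).1 (pr k).2 θ)) ∧
    Q (k + 1) = Q k * givens n (pr k).1 (pr k).2 θ

lemma transform_sym (n : ℕ) (A : Fin n → Fin n → Fin n → ℝ) (hA : IsSymT n A)
    (Q : Matrix (Fin n) (Fin n) ℝ) : IsSymT n (transform n A Q) := by
  intro i j k
  constructor
  · unfold transform
    rw [Finset.sum_comm]
    refine Finset.sum_congr rfl fun p _ => Finset.sum_congr rfl fun q _ =>
      Finset.sum_congr rfl fun r _ => ?_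
    rw [(hA q p r).1]; ring
  · unfold transform
    refine Finset.sum_congr rfl fun p _ => ?_
    rw [Finset.sum_comm]
    refine Finset.sum_congr rfl fun q _ =>
      Finset.sum_congr rfl fun r _ => ?_
    rw [(hA p r q).2]; ring

lemma transform_comb (n : ℕ) (A : Fin n → Fin n → Fin n → ℝ) (hA : IsSymT n A)
    (Q Q' : Matrix (Fin n) (Fin n) ℝ) (i j l : Fin n) (c s : ℝ)
    (h : ∀ p, Q' p l = c * Q p i + s * Q p j) :
    transform n A Q' l l l = c ^ 3 * transform n A Q i i i + 3 * c ^ 2 * s * transform n A Q i i j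
      + 3 * c * s ^ 2 * transform n A Q i j j + s ^ 3 * transform n A Q j j j := by
  have hW := transform_sym n A hA Q
  have e1 : transform n A Q i j i = transform n A Q i i j := (hW i j i).2
  have e2 : transform n A Q j i i = transform n A Q i i j := by rw [(hW j i i).1, e1]
  have e3 : transform n A Q j i j = transform n A Q i j j := (hW j i j).1
  have e4 : transform n A Q j j i = transform n A Q i j j := by rw [(hW j j i).2, e3]
  have key : transform n A Q' l l l = c ^ 3 * transform n A Q i i i
      + c ^ 2 * s * transform n A Q i i j + c ^ 2 * s * transform n A Q i j i
      + c ^ 2 * s * transform n A Q j i i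
      + c * s ^ 2 * transform n A Q i j j + c * s ^ 2 * transform n A Q j i j
      + c * s ^ 2 * transform n A Q j j i + s ^ 3 * transform n A Q j j j := by
    simp only [transform, h, Finset.mul_sum, ← Finset.sum_add_distrib]
    refine Finset.sum_congr rfl fun p _ => Finset.sum_congr rfl fun q _ =>
      Finset.sum_congr rfl fun r _ => ?_
    ring
  rw [key, e1, e2, e3, e4]; ring

lemma mul_givens_i (n : ℕ) (Q : Matrix (Fin n) (Fin n) ℝ) (i j : Fin n) (hij : i ≠ j) (θ : ℝ)
    (p : Fin n) :
    (Q * givens n i j θ) p i = Real.cos θ * Q p i + Real.sin θ * Q p j := by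
  have h : ∀ x, Q p x * givens n i j θ x i
      = (if x = i then Real.cos θ * Q p i else 0) + (if x = j then Real.sin θ * Q p j else 0) := by
    intro x
    by_cases h1 : x = i
    · subst h1; simp [givens, hij]; ring
    · by_cases h2 : x = j
      · subst h2; simp [givens, h1]; ring
      · simp [givens, h1, h2]
  rw [Matrix.mul_apply, Finset.sum_congr rfl fun x _ => h x, Finset.sum_add_distrib]
  simp

lemma mul_givens_j (n : ℕ) (Q : Matrix (Fin n) (Fin n) ℝ) (i j : Fin n) (hij : i ≠ j) (θ : ℝ)
    (p : Fin n) :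
    (Q * givens n i j θ) p j = (-Real.sin θ) * Q p i + Real.cos θ * Q p j := by
  have h : ∀ x, Q p x * givens n i j θ x j
      = (if x = i then (-Real.sin θ) * Q p i else 0)
        + (if x = j then Real.cos θ * Q p j else 0) := by
    intro x
    by_cases h1 : x = i
    · subst h1; simp [givens, hij]; ring
    · by_cases h2 : x = j
      · subst h2; simp [givens, h1]; ring
      · simp [givens, h1, h2]
  rw [Matrix.mul_apply, Finset.sum_congr rfl fun x _ => h x, Finset.sum_add_distrib]
  simp

lemma mul_givens_o (n : ℕ) (Q : Matrix (Fin n) (Fin n) ℝ) (i j l : Fin n) (hi : l ≠ i)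
    (hj : l ≠ j) (θ : ℝ) (p : Fin n) :
    (Q * givens n i j θ) p l = Q p l := by
  have h : ∀ x, Q p x * givens n i j θ x l = (if x = l then Q p l else 0) := by
    intro x
    by_cases h1 : x = l
    · subst h1; simp [givens, hi, hj]
    · simp [givens, h1, hi, hj]
  rw [Matrix.mul_apply, Finset.sum_congr rfl fun x _ => h x]
  simp

lemma fObj_givens (n : ℕ) (A : Fin n → Fin n → Fin n → ℝ) (hA : IsSymT n A)
    (Q : Matrix (Fin n) (Fin n) ℝ) (i j : Fin n) (hij : i ≠ j) (θ : ℝ) :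
    fObj n A (Q * givens n i j θ) - fObj n A Q =
      6 * dT n (transform n A Q) i j * (Real.cos θ * Real.sin θ)
        * (Real.cos θ ^ 2 - Real.sin θ ^ 2)
      - 3 * ωT n (transform n A Q) i j * (Real.cos θ * Real.sin θ) ^ 2 := by
  have hi := transform_comb n A hA Q (Q * givens n i j θ) i j i _ _ (mul_givens_i n Q i j hij θ)
  have hj := transform_comb n A hA Q (Q * givens n i j θ) i j j _ _ (mul_givens_j n Q i j hij θ)
  have hsub : fObj n A (Q * givens n i j θ) - fObj n A Q =
      ((transform n A (Q * givens n i j θ) i i i) ^ 2 - (transform n A Q i i i) ^ 2) +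
      ((transform n A (Q * givens n i j θ) j j j) ^ 2 - (transform n A Q j j j) ^ 2) := by
    unfold fObj
    rw [← Finset.sum_sub_distrib]
    refine Finset.sum_eq_add_of_mem i j (Finset.mem_univ _) (Finset.mem_univ _) hij ?_
    rintro l - ⟨h1, h2⟩
    simp [transform, mul_givens_o n Q i j l h1 h2 θ]
  rw [hsub, hi, hj]
  unfold dT ωT
  generalize transform n A Q i i i = a
  generalize transform n A Q i i j = b
  generalize transform n A Q i j j = e
  generalize transform n A Q j j j = g
  have hc := Real.sin_sq_add_cos_sq θ
  generalize Real.cos θ = c at *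
  generalize Real.sin θ = s at *
  have h3 : a ^ 2 + g ^ 2 = (a ^ 2 + g ^ 2) * (s ^ 2 + c ^ 2) ^ 3 := by rw [hc]; ring
  have h1 : 6 * (a * b - e * g) * (c * s) * (c ^ 2 - s ^ 2)
      - 3 * (a ^ 2 + g ^ 2 - 3 * b ^ 2 - 3 * e ^ 2 - 2 * a * e - 2 * b * g) * (c * s) ^ 2
      = (6 * (a * b - e * g) * (c * s) * (c ^ 2 - s ^ 2)
      - 3 * (a ^ 2 + g ^ 2 - 3 * b ^ 2 - 3 * e ^ 2 - 2 * a * e - 2 * b * g) * (c * s) ^ 2)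
        * (s ^ 2 + c ^ 2) := by rw [hc]; ring
  rw [h1]
  linear_combination -h3

lemma mem_pairList (n : ℕ) (i j : Fin n) (h : i < j) : (i, j) ∈ pairList n := by
  simp [pairList, h]

lemma fObj_cont (n : ℕ) (A : Fin n → Fin n → Fin n → ℝ) : Continuous (fObj n A) := by
  unfold fObj transform
  fun_prop

lemma max_limit (n : ℕ) (A : Fin n → Fin n → Fin n → ℝ)
    (pr : ℕ → Fin n × Fin n) (hpr : CyclicPairs n pr)
    (Q : ℕ → Matrix (Fin n) (Fin n) ℝ) (hQ : JacobiIterates n A pr Q)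
    (Qstar : Matrix (Fin n) (Fin n) ℝ)
    (hconv : Filter.Tendsto Q Filter.atTop (nhds Qstar)) (i j : Fin n) (h : i < j) (θ : ℝ) :
    fObj n A (Qstar * givens n i j θ) ≤ fObj n A Qstar := by
  obtain ⟨m, hm, hmm⟩ := List.mem_iff_getElem.1 (mem_pairList n i j h)
  have hpos : 0 < (pairList n).length := by omega
  set N := (pairList n).length with hN
  let φ : ℕ → ℕ := fun k => m + N * k
  have hφp : ∀ k, pr (φ k) = (i, j) := by
    intro k
    have := hpr (φ k)
    rw [← hN] at this
    have h2 : φ k % N = m := by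
      simp only [φ, Nat.add_mul_mod_self_left]
      exact Nat.mod_eq_of_lt hm
    rw [h2, List.getElem?_eq_getElem hm, hmm] at this
    exact (Option.some.inj this).symm
  have hφ : Filter.Tendsto φ Filter.atTop Filter.atTop := by
    refine Filter.tendsto_atTop_mono (fun k => ?_) Filter.tendsto_id
    simp only [φ, id]
    nlinarith
  have t1 : Filter.Tendsto (fun k => fObj n A (Q (φ k) * givens n i j θ)) Filter.atTop
      (nhds (fObj n A (Qstar * givens n i j θ))) :=
    ((fObj_cont n A).tendsto _).comp ((hconv.comp hφ).mul_const _)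
  have t2 : Filter.Tendsto (fun k => fObj n A (Q (φ k + 1))) Filter.atTop
      (nhds (fObj n A Qstar)) :=
    ((fObj_cont n A).tendsto _).comp
      (hconv.comp ((Filter.tendsto_add_atTop_nat 1).comp hφ))
  refine le_of_tendsto_of_tendsto' t1 t2 fun k => ?_
  obtain ⟨θ₀, -, h1, h2⟩ := hQ.2 (φ k)
  rw [h2]
  have := h1 θ
  rw [hφp k] at this ⊢
  exact this

/-- Proposition 6.3 / `theorem-convergence-stationary`.
If the iterates `Q_k` of the cyclic Jacobi algorithm applied to a symmetric `A ∈ S_n`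
converge to `Q_*`, then `W^* = A·(Q_*,Q_*,Q_*)` satisfies `d_{i,j}(W^*) = 0` and
`ω_{i,j}(W^*) ≥ 0` for all `i < j`. -/
theorem stmt_16 (n : ℕ) (hn : 2 ≤ n) (A : Fin n → Fin n → Fin n → ℝ) (hA : IsSymT n A)
    (pr : ℕ → Fin n × Fin n) (hpr : CyclicPairs n pr)
    (Q : ℕ → Matrix (Fin n) (Fin n) ℝ) (hQ : JacobiIterates n A pr Q)
    (Qstar : Matrix (Fin n) (Fin n) ℝ)
    (hconv : Filter.Tendsto Q Filter.atTop (nhds Qstar)) :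
    ∀ i j : Fin n, i < j →
      dT n (transform n A Qstar) i j = 0 ∧ 0 ≤ ωT n (transform n A Qstar) i j := by
  intro i j hij
  have H : ∀ θ : ℝ, 2 * dT n (transform n A Qstar) i j * (Real.cos θ * Real.sin θ)
        * (Real.cos θ ^ 2 - Real.sin θ ^ 2)
      ≤ ωT n (transform n A Qstar) i j * (Real.cos θ * Real.sin θ) ^ 2 := by
    intro θ
    have h1 := fObj_givens n A hA Qstar i j hij.ne θ
    have h2 := max_limit n A pr hpr Q hQ Qstar hconv i j hij θ
    linarith
  generalize dT n (transform n A Qstar) i j = d at *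
  generalize ωT n (transform n A Qstar) i j = w at *
  have hw : 0 ≤ w := by
    have := H (Real.pi / 4)
    rw [Real.cos_pi_div_four, Real.sin_pi_div_four] at this
    have h2 : (√2 / 2 * (√2 / 2) : ℝ) = 1 / 2 := by
      have := Real.mul_self_sqrt (show (0 : ℝ) ≤ 2 by norm_num)
      linarith
    rw [h2] at this
    linarith
  refine ⟨?_, hw⟩
  have T : ∀ t : ℝ, 2 * d * t * (1 - t ^ 2) ≤ w * t ^ 2 := by
    intro t
    have h := H (Real.arctan t)
    have hc := Real.cos_arctan_pos t
    have hs : Real.sin (Real.arctan t) = t * Real.cos (Real.arctan t) := by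
      conv_rhs => rw [← Real.tan_arctan t, Real.arctan_tan (Real.neg_pi_div_two_lt_arctan t)
        (Real.arctan_lt_pi_div_two t)]
      rw [Real.tan_mul_cos hc.ne']
    rw [hs] at h
    generalize Real.cos (Real.arctan t) = c at *
    have hc4 : 0 < c ^ 4 := by positivity
    refine le_of_mul_le_mul_right ?_ hc4
    linarith
  by_contra hd
  have hd2 : 0 < d ^ 2 := by positivity
  obtain ⟨K, hK⟩ : ∃ K, K = w + 2 + 2 * |d| := ⟨_, rfl⟩
  have habs := abs_nonneg d
  have hK0 : 0 < K := by linarith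
  have h := T (d / K)
  have e : 2 * d * (d / K) * (1 - (d / K) ^ 2) = d ^ 2 / K ^ 3 * (2 * (K ^ 2 - d ^ 2)) := by
    field_simp
  have e2 : w * (d / K) ^ 2 = d ^ 2 / K ^ 3 * (w * K) := by
    field_simp
  rw [e, e2] at h
  have h' := le_of_mul_le_mul_left h (by positivity)
  have hdd : d ^ 2 = |d| ^ 2 := (sq_abs d).symm
  rw [hdd] at h'
  nlinarith [mul_nonneg hw habs]
end
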